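/- arXiv:hep-th/0204097 — 5 statements merged into one kernel-verified Lean document; each statement's English description precedes it below -/
import Mathlib

section
/- (Lemma 2, fourth identity, eq. (4.6).) For every ν ∈ ℝ, every integer n ≥ 1, and every admissible θ ∈ ℂ^n: 2·sin(πν/2)·(Σ_{i=1}^n e^{θ_i})·(Σ_{i=1}^n e^{−θ_i})·K̃_n^{(1)}(θ) = K̃_n^{+}(θ) + K̃_n^{−}(θ). -/
open Finset

/-- The K-function `K_n[p](θ)` from the paper (eq. (1.2)):
`K_n[p](θ) = Σ_{l ∈ {0,1}^n} (−1)^{l_1+…+l_n} Π_{i<j} (1 + (l_i − l_j)·i·sin(πν)/sinh(θ_i − θ_j)) · p(θ,l)`. -/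
noncomputable def Kfun (ν : ℝ) {n : ℕ} (p : (Fin n → ℂ) → (Fin n → Fin 2) → ℂ)
    (θ : Fin n → ℂ) : ℂ :=
  ∑ l : Fin n → Fin 2,
    (-1 : ℂ) ^ (∑ i, (l i : ℕ)) *
    (∏ i : Fin n, ∏ j : Fin n,
      if (i : ℕ) < (j : ℕ) then
        1 + (((l i : ℕ) : ℂ) - ((l j : ℕ) : ℂ)) * Complex.I *
          (Real.sin (Real.pi * ν) : ℂ) / Complex.sinh (θ i - θ j)
      else 1) *
    p θ l

/-- `θ` is admissible if `sinh(θ_i − θ_j) ≠ 0` for all `i < j`. -/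
def Admissible {n : ℕ} (θ : Fin n → ℂ) : Prop :=
  ∀ i j : Fin n, i < j → Complex.sinh (θ i - θ j) ≠ 0

/-- p-function of the N-th power of the field: `p^{(N)}(θ,l) = (Σ_i (−1)^{l_i})^N`. -/
noncomputable def pN (N : ℕ) {n : ℕ} : (Fin n → ℂ) → (Fin n → Fin 2) → ℂ :=
  fun _ l => (∑ i, (-1 : ℂ) ^ (l i : ℕ)) ^ N

/-- p-function of the special exponentials `e^{±iβφ}` (ε = ±1):
`p^{±}(θ,l) = (Σ_i e^{∓θ_i}) · (Σ_i e^{±(θ_i − (iπ/2)(1 − (−1)^{l_i} ν))})`. -/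
noncomputable def pPM (ν : ℝ) (ε : ℂ) {n : ℕ} : (Fin n → ℂ) → (Fin n → Fin 2) → ℂ :=
  fun θ l => (∑ i, Complex.exp (-ε * θ i)) *
    (∑ i, Complex.exp (ε * (θ i -
      (Real.pi : ℂ) * Complex.I / 2 * (1 - (-1 : ℂ) ^ (l i : ℕ) * (ν : ℂ)))))

lemma quadratic_prod_coeff {ι : Type*} (A : Finset ι) (f g : ι → ℂ) :
    let P := ∏ j ∈ A, (Polynomial.X ^ 2 + Polynomial.C (f j) * Polynomial.X + Polynomial.C (g j))
    P.natDegree = 2 * #A ∧ P.coeff (2 * #A) = 1 ∧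
      (0 < #A → P.coeff (2 * #A - 1) = ∑ j ∈ A, f j) := by
  intro P
  have hd : ∀ j, (Polynomial.X ^ 2 + Polynomial.C (f j) * Polynomial.X
      + Polynomial.C (g j)).natDegree = 2 := fun j => by compute_degree!
  have hm : ∀ j, (Polynomial.X ^ 2 + Polynomial.C (f j) * Polynomial.X
      + Polynomial.C (g j)).Monic := fun j => by monicity!
  have hP : P.natDegree = 2 * #A := by
    rw [Polynomial.natDegree_prod_of_monic _ _ fun j _ => hm j, sum_congr rfl fun j _ => hd j,
      sum_const, smul_eq_mul, mul_comm]
  have hPm : P.Monic := Polynomial.monic_prod_of_monic _ _ fun j _ => hm j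
  refine ⟨hP, hP ▸ hPm, fun h0 => ?_⟩
  rw [← hP, ← Polynomial.nextCoeff_of_natDegree_pos (by omega),
    Polynomial.Monic.nextCoeff_prod _ _ fun j _ => hm j]
  refine sum_congr rfl fun j _ => ?_
  rw [Polynomial.nextCoeff_of_natDegree_pos (by simp [hd]), hd]
  simp [Polynomial.coeff_C, Polynomial.coeff_X_pow]

section SubsetSums

variable {ι : Type*} [DecidableEq ι]

/-- The signed product of pair factors attached to a splitting of `A` into `A \ S` and `S`. -/
noncomputable def pairWeight (b : ℂ) (x : ι → ℂ) (A S : Finset ι) : ℂ :=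
  (-1) ^ #S * ∏ i ∈ A \ S, ∏ j ∈ S, (1 - b * x i * x j / (x i ^ 2 - x j ^ 2))

/-- The sign `(−1)^{l_i}` attached to the indicator `l` of `S`. -/
noncomputable def subsetSign (S : Finset ι) (i : ι) : ℂ := if i ∈ S then -1 else 1

/-- The combination of signed sums whose weighted sum over all subsets vanishes. -/
noncomputable def fieldKernel (x : ι → ℂ) (A S : Finset ι) : ℂ :=
  2 * (∑ i ∈ A, x i) * (∑ i ∈ A, (x i)⁻¹) * (∑ i ∈ A, subsetSign S i)
    - (∑ i ∈ A, (x i)⁻¹) * (∑ i ∈ A, subsetSign S i * x i)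
    - (∑ i ∈ A, x i) * (∑ i ∈ A, subsetSign S i * (x i)⁻¹)

/-- Numerator of the pair factors joining a new point `X`, not in the subset, to `A`. -/
noncomputable def outPoly (b : ℂ) (x : ι → ℂ) (A S : Finset ι) : Polynomial ℂ :=
  ∏ j ∈ A, (Polynomial.X ^ 2 + Polynomial.C (if j ∈ S then -(b * x j) else 0) * Polynomial.X
    + Polynomial.C (-(x j) ^ 2))

/-- Numerator of the pair factors joining a new point `X`, in the subset, to `A`. -/
noncomputable def inPoly (b : ℂ) (x : ι → ℂ) (A S : Finset ι) : Polynomial ℂ :=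
  ∏ j ∈ A, (Polynomial.X ^ 2 + Polynomial.C (if j ∈ S then 0 else b * x j) * Polynomial.X
    + Polynomial.C (-(x j) ^ 2))

lemma pairWeight_insert_left (b : ℂ) (x : ι → ℂ) {A S : Finset ι} {a : ι} (ha : a ∉ A)
    (hS : S ⊆ A) :
    pairWeight b x (insert a A) S =
      pairWeight b x A S * ∏ j ∈ S, (1 - b * x a * x j / (x a ^ 2 - x j ^ 2)) := by
  have haS : a ∉ S := fun h => ha (hS h)
  rw [pairWeight, pairWeight, insert_sdiff_of_notMem _ haS, prod_insert (by simp [ha])]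
  ring

lemma pairWeight_insert_right (b : ℂ) (x : ι → ℂ) {A S : Finset ι} {a : ι} (ha : a ∉ A)
    (hS : S ⊆ A) :
    pairWeight b x (insert a A) (insert a S) =
      -(pairWeight b x A S * ∏ i ∈ A \ S, (1 - b * x i * x a / (x i ^ 2 - x a ^ 2))) := by
  have haS : a ∉ S := fun h => ha (hS h)
  have h : insert a A \ insert a S = A \ S := by
    ext i; simp only [mem_sdiff, mem_insert]
    constructor
    · rintro ⟨h | h, h'⟩ <;> simp_all
    · rintro ⟨h, h'⟩
      exact ⟨.inr h, by rintro (rfl | h'') <;> contradiction⟩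
  rw [pairWeight, pairWeight, h, card_insert_of_notMem haS]
  simp only [prod_insert haS, prod_mul_distrib]
  ring

lemma sum_powerset_insert_pairWeight (b : ℂ) (x : ι → ℂ) {A : Finset ι} {a : ι} (ha : a ∉ A)
    (p : Finset ι → ℂ) :
    ∑ S ∈ (insert a A).powerset, pairWeight b x (insert a A) S * p S =
      ∑ S ∈ A.powerset, pairWeight b x A S *
        ((∏ j ∈ S, (1 - b * x a * x j / (x a ^ 2 - x j ^ 2))) * p S
          - (∏ i ∈ A \ S, (1 - b * x i * x a / (x i ^ 2 - x a ^ 2))) * p (insert a S)) := by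
  rw [sum_powerset_insert ha, ← sum_add_distrib]
  refine sum_congr rfl fun S hS => ?_
  rw [pairWeight_insert_left b x ha (mem_powerset.1 hS),
    pairWeight_insert_right b x ha (mem_powerset.1 hS)]
  ring

lemma prod_eq_prod_ite_of_subset {A S : Finset ι} (hS : S ⊆ A) (f : ι → ℂ) :
    ∏ j ∈ S, f j = ∏ j ∈ A, if j ∈ S then f j else 1 := by
  rw [prod_ite_mem, inter_eq_right.2 hS]

lemma prod_sdiff_eq_prod_ite (A S : Finset ι) (f : ι → ℂ) :
    ∏ j ∈ A \ S, f j = ∏ j ∈ A, if j ∈ S then 1 else f j := by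
  rw [← filter_notMem_eq_sdiff, prod_filter]
  exact prod_congr rfl fun j _ => by split_ifs <;> simp_all

/-- Clearing denominators when a point is added: the weighted sum becomes a polynomial in the
new coordinate. -/
lemma prod_mul_sum_powerset_insert (b : ℂ) (x : ι → ℂ) {A : Finset ι} {a : ι} (ha : a ∉ A)
    (hx : ∀ j ∈ A, x a ^ 2 - x j ^ 2 ≠ 0) (p : Finset ι → ℂ) :
    (∏ j ∈ A, (x a ^ 2 - x j ^ 2)) *
        ∑ S ∈ (insert a A).powerset, pairWeight b x (insert a A) S * p S =
      ∑ S ∈ A.powerset, pairWeight b x A S *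
        ((outPoly b x A S).eval (x a) * p S - (inPoly b x A S).eval (x a) * p (insert a S)) := by
  rw [sum_powerset_insert_pairWeight b x ha, mul_sum]
  refine sum_congr rfl fun S hS => ?_
  have h1 : (outPoly b x A S).eval (x a) = (∏ j ∈ A, (x a ^ 2 - x j ^ 2)) *
      ∏ j ∈ S, (1 - b * x a * x j / (x a ^ 2 - x j ^ 2)) := by
    rw [prod_eq_prod_ite_of_subset (mem_powerset.1 hS), ← prod_mul_distrib, outPoly,
      Polynomial.eval_prod]
    refine prod_congr rfl fun j hj => ?_
    have := hx j hj
    split_ifs <;> simp <;> field_simp <;> ring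
  have h2 : (inPoly b x A S).eval (x a) = (∏ j ∈ A, (x a ^ 2 - x j ^ 2)) *
      ∏ i ∈ A \ S, (1 - b * x i * x a / (x i ^ 2 - x a ^ 2)) := by
    rw [prod_sdiff_eq_prod_ite, ← prod_mul_distrib, inPoly, Polynomial.eval_prod]
    refine prod_congr rfl fun j hj => ?_
    have := hx j hj
    have h' : x j ^ 2 - x a ^ 2 ≠ 0 := fun h => this (by linear_combination -h)
    split_ifs <;> simp <;> field_simp <;> ring
  rw [h1, h2]
  ring

/-- The residue-type evaluation at a point `t = ± x c` with `c ∈ A`. -/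
lemma sum_eval_of_sq_eq (b : ℂ) (x : ι → ℂ) {B : Finset ι} {c : ι} (hc : c ∉ B) {t : ℂ}
    (ht : t ^ 2 = x c ^ 2) (p q : Finset ι → ℂ) :
    ∑ S ∈ (insert c B).powerset, pairWeight b x (insert c B) S *
        ((outPoly b x (insert c B) S).eval t * p S + (inPoly b x (insert c B) S).eval t * q S) =
      b * x c * t * ∑ S ∈ B.powerset, pairWeight b x B S *
        ((∏ j ∈ S, (1 - b * x c * x j / (x c ^ 2 - x j ^ 2))) * (inPoly b x B S).eval t * q S
          + (∏ i ∈ B \ S, (1 - b * x i * x c / (x i ^ 2 - x c ^ 2))) *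
            (outPoly b x B S).eval t * p (insert c S)) := by
  rw [sum_powerset_insert_pairWeight b x hc, mul_sum]
  refine sum_congr rfl fun S hS => ?_
  have hcS : c ∉ S := fun h => hc (mem_powerset.1 hS h)
  have h1 : (outPoly b x (insert c B) S).eval t = 0 := by
    simp [outPoly, prod_insert hc, hcS, ht]
  have h2 : (inPoly b x (insert c B) (insert c S)).eval t = 0 := by
    simp [inPoly, prod_insert hc, ht]
  have h3 : (inPoly b x (insert c B) S).eval t = b * x c * t * (inPoly b x B S).eval t := by
    simp [inPoly, prod_insert hc, hcS, ht]
  have h4 : outPoly b x B (insert c S) = outPoly b x B S := by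
    unfold outPoly
    refine prod_congr rfl fun j hj => ?_
    have hjc : j ≠ c := fun h => hc (h ▸ hj)
    simp only [mem_insert, hjc, false_or]
  have h5 : (outPoly b x (insert c B) (insert c S)).eval t =
      -(b * x c * t) * (outPoly b x B S).eval t := by
    rw [← h4, outPoly, prod_insert hc, Polynomial.eval_mul, ← outPoly]
    simp [ht]
  rw [h1, h2, h3, h5]
  ring

section Evaluation

variable (b : ℂ) (x : ι → ℂ) {B S : Finset ι} {y : ℂ}

lemma prod_mul_inPoly_eval_self (hS : S ⊆ B) (hx : ∀ j ∈ B, y ^ 2 - x j ^ 2 ≠ 0) :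
    (∏ j ∈ S, (1 - b * y * x j / (y ^ 2 - x j ^ 2))) * (inPoly b x B S).eval y =
      ∏ j ∈ B, (y ^ 2 - x j ^ 2 + subsetSign S j * (b * x j * y)) := by
  rw [prod_eq_prod_ite_of_subset hS, inPoly, Polynomial.eval_prod, ← prod_mul_distrib]
  refine prod_congr rfl fun j hj => ?_
  have := hx j hj
  unfold subsetSign
  split_ifs <;> simp <;> field_simp <;> ring

lemma prod_mul_outPoly_eval_self (hx : ∀ j ∈ B, y ^ 2 - x j ^ 2 ≠ 0) :
    (∏ i ∈ B \ S, (1 - b * x i * y / (x i ^ 2 - y ^ 2))) * (outPoly b x B S).eval y =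
      ∏ j ∈ B, (y ^ 2 - x j ^ 2 + subsetSign S j * (b * x j * y)) := by
  rw [prod_sdiff_eq_prod_ite, outPoly, Polynomial.eval_prod, ← prod_mul_distrib]
  refine prod_congr rfl fun j hj => ?_
  have := hx j hj
  have h' : x j ^ 2 - y ^ 2 ≠ 0 := fun h => this (by linear_combination -h)
  unfold subsetSign
  split_ifs <;> simp <;> field_simp <;> ring

lemma prod_mul_inPoly_eval_neg (hS : S ⊆ B) (hx : ∀ j ∈ B, y ^ 2 - x j ^ 2 ≠ 0) :
    (∏ j ∈ S, (1 - b * y * x j / (y ^ 2 - x j ^ 2))) * (inPoly b x B S).eval (-y) =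
      ∏ j ∈ B, (y ^ 2 - x j ^ 2 - b * x j * y) := by
  rw [prod_eq_prod_ite_of_subset hS, inPoly, Polynomial.eval_prod, ← prod_mul_distrib]
  refine prod_congr rfl fun j hj => ?_
  have := hx j hj
  split_ifs <;> simp <;> field_simp <;> ring

lemma prod_mul_outPoly_eval_neg (hx : ∀ j ∈ B, y ^ 2 - x j ^ 2 ≠ 0) :
    (∏ i ∈ B \ S, (1 - b * x i * y / (x i ^ 2 - y ^ 2))) * (outPoly b x B S).eval (-y) =
      ∏ j ∈ B, (y ^ 2 - x j ^ 2 + b * x j * y) := by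
  rw [prod_sdiff_eq_prod_ite, outPoly, Polynomial.eval_prod, ← prod_mul_distrib]
  refine prod_congr rfl fun j hj => ?_
  have := hx j hj
  have h' : x j ^ 2 - y ^ 2 ≠ 0 := fun h => this (by linear_combination -h)
  split_ifs <;> simp <;> field_simp <;> ring

end Evaluation

lemma sum_eval_self (b : ℂ) (x : ι → ℂ) {B : Finset ι} {c : ι} (hc : c ∉ B)
    (hx : ∀ j ∈ B, x c ^ 2 - x j ^ 2 ≠ 0) (p q : Finset ι → ℂ)
    (hpq : ∀ S ⊆ B, p (insert c S) + q S = 0) :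
    ∑ S ∈ (insert c B).powerset, pairWeight b x (insert c B) S *
        ((outPoly b x (insert c B) S).eval (x c) * p S
          + (inPoly b x (insert c B) S).eval (x c) * q S) = 0 := by
  rw [sum_eval_of_sq_eq b x hc rfl]
  refine mul_eq_zero_of_right _ (sum_eq_zero fun S hS => ?_)
  rw [prod_mul_inPoly_eval_self b x (mem_powerset.1 hS) hx, prod_mul_outPoly_eval_self b x hx,
    ← mul_add, add_comm, hpq S (mem_powerset.1 hS)]
  simp

lemma sum_eval_neg (b : ℂ) (x : ι → ℂ) {B : Finset ι} {c : ι} (hc : c ∉ B)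
    (hx : ∀ j ∈ B, x c ^ 2 - x j ^ 2 ≠ 0) (p q : Finset ι → ℂ) :
    ∑ S ∈ (insert c B).powerset, pairWeight b x (insert c B) S *
        ((outPoly b x (insert c B) S).eval (-x c) * p S
          + (inPoly b x (insert c B) S).eval (-x c) * q S) =
      b * x c * -x c *
        ((∏ j ∈ B, (x c ^ 2 - x j ^ 2 - b * x j * x c)) *
            ∑ S ∈ B.powerset, pairWeight b x B S * q S
          + (∏ j ∈ B, (x c ^ 2 - x j ^ 2 + b * x j * x c)) *
            ∑ S ∈ B.powerset, pairWeight b x B S * p (insert c S)) := by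
  rw [sum_eval_of_sq_eq b x hc (by ring)]
  congr 1
  rw [mul_sum, mul_sum, ← sum_add_distrib]
  refine sum_congr rfl fun S hS => ?_
  rw [prod_mul_inPoly_eval_neg b x (mem_powerset.1 hS) hx, prod_mul_outPoly_eval_neg b x hx]
  ring

lemma eq_zero_of_eval_signed {A : Finset ι} {x : ι → ℂ} (h0 : ∀ i ∈ A, x i ≠ 0)
    (hx : ∀ i ∈ A, ∀ j ∈ A, i ≠ j → x i ^ 2 - x j ^ 2 ≠ 0) {P : Polynomial ℂ}
    (hself : ∀ i ∈ A, P.eval (x i) = 0) (hneg : ∀ i ∈ A, P.eval (-x i) = 0)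
    (hdeg : P.natDegree < 2 * #A ∨ P.eval 0 = 0 ∧ P.natDegree < 2 * #A + 1) : P = 0 := by
  let f : A × Bool → ℂ := fun k => if k.2 then x k.1 else -x k.1
  have hf0 : ∀ k, f k ≠ 0 := by
    rintro ⟨⟨i, hi⟩, _ | _⟩ <;> simp [f, h0 i hi]
  have hf : Function.Injective f := by
    rintro ⟨⟨i, hi⟩, k⟩ ⟨⟨j, hj⟩, l⟩ h
    have hij : i = j := by
      by_contra hne
      refine hx i hi j hj hne ?_
      have h2 : f ⟨⟨i, hi⟩, k⟩ ^ 2 = f ⟨⟨j, hj⟩, l⟩ ^ 2 := by rw [h]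
      cases k <;> cases l <;> simp [f] at h2 <;> linear_combination h2
    subst hij
    have := h0 i hi
    cases k <;> cases l <;> simp [f, neg_eq_self, self_eq_neg, this] at h ⊢
  have hev : ∀ k, P.eval (f k) = 0 := by
    rintro ⟨⟨i, hi⟩, _ | _⟩
    · simpa [f] using hneg i hi
    · simpa [f] using hself i hi
  rcases hdeg with hdeg | ⟨hP0, hdeg⟩
  · refine Polynomial.eq_zero_of_natDegree_lt_card_of_eval_eq_zero P hf hev ?_
    simpa [mul_comm] using hdeg
  · refine Polynomial.eq_zero_of_natDegree_lt_card_of_eval_eq_zero (ι := Option (A × Bool)) P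
      (f := fun k => k.elim 0 f) ?_ ?_ ?_
    · rintro (_ | k) (_ | l) h
      · rfl
      · exact absurd h.symm (hf0 l)
      · exact absurd h (hf0 k)
      · exact congrArg some (hf h)
    · rintro (_ | k)
      · exact hP0
      · exact hev k
    · simpa [mul_comm] using hdeg


lemma subsetSign_insert_self (S : Finset ι) (c : ι) : subsetSign (insert c S) c = -1 := by
  simp [subsetSign]

lemma subsetSign_of_notMem {S : Finset ι} {c : ι} (hc : c ∉ S) : subsetSign S c = 1 := by
  simp [subsetSign, hc]

lemma sum_subsetSign_insert {B : Finset ι} {c : ι} (hc : c ∉ B) (S : Finset ι) (f : ι → ℂ) :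
    ∑ i ∈ B, subsetSign (insert c S) i * f i = ∑ i ∈ B, subsetSign S i * f i := by
  refine sum_congr rfl fun i hi => ?_
  have : i ≠ c := fun h => hc (h ▸ hi)
  simp [subsetSign, this]

lemma outPoly_coeff (b : ℂ) (x : ι → ℂ) (A S : Finset ι) :
    (outPoly b x A S).natDegree = 2 * #A ∧ (outPoly b x A S).coeff (2 * #A) = 1 ∧
      (0 < #A → (outPoly b x A S).coeff (2 * #A - 1) = ∑ j ∈ A, if j ∈ S then -(b * x j) else 0) :=
  quadratic_prod_coeff A _ _

lemma inPoly_coeff (b : ℂ) (x : ι → ℂ) (A S : Finset ι) :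
    (inPoly b x A S).natDegree = 2 * #A ∧ (inPoly b x A S).coeff (2 * #A) = 1 ∧
      (0 < #A → (inPoly b x A S).coeff (2 * #A - 1) = ∑ j ∈ A, if j ∈ S then 0 else b * x j) :=
  quadratic_prod_coeff A _ _

lemma natDegree_lt_of_coeff_eq_zero {P : Polynomial ℂ} {n : ℕ} (hP : P.natDegree ≤ n)
    (hn : 0 < n) (h : P.coeff n = 0) : P.natDegree < n := by
  refine lt_of_le_of_ne hP fun he => ?_
  have : P = 0 := by
    rw [← Polynomial.leadingCoeff_eq_zero, Polynomial.leadingCoeff, he, h]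
  simp [this] at he
  omega

theorem sum_pairWeight_eq_zero (b : ℂ) (x : ι → ℂ) (A : Finset ι) (hA : A.Nonempty)
    (h0 : ∀ i ∈ A, x i ≠ 0) (hx : ∀ i ∈ A, ∀ j ∈ A, i ≠ j → x i ^ 2 - x j ^ 2 ≠ 0) :
    ∑ S ∈ A.powerset, pairWeight b x A S = 0 := by
  induction A using Finset.strongInduction with
  | H A ih =>
  obtain ⟨a, haA⟩ := hA
  obtain ⟨A, ha, rfl⟩ : ∃ A', a ∉ A' ∧ insert a A' = A :=
    ⟨A.erase a, notMem_erase a A, insert_erase haA⟩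
  have hxa : ∀ j ∈ A, x a ^ 2 - x j ^ 2 ≠ 0 := fun j hj =>
    hx a (mem_insert_self _ _) j (mem_insert_of_mem hj) fun h => ha (h ▸ hj)
  have key := prod_mul_sum_powerset_insert b x ha hxa fun _ => 1
  simp only [mul_one] at key
  refine (mul_eq_zero.1 (key.trans ?_)).resolve_left (prod_ne_zero_iff.2 hxa)
  rcases A.eq_empty_or_nonempty with rfl | hAne
  · simp [outPoly, inPoly]
  let P : Polynomial ℂ := ∑ S ∈ A.powerset,
    Polynomial.C (pairWeight b x A S) * (outPoly b x A S - inPoly b x A S)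
  have hev : ∀ t, P.eval t = ∑ S ∈ A.powerset, pairWeight b x A S *
      ((outPoly b x A S).eval t * 1 + (inPoly b x A S).eval t * (-1)) := fun t => by
    simp [P, Polynomial.eval_finsetSum, sub_eq_add_neg]
  have hroots : ∀ c ∈ A, P.eval (x c) = 0 ∧ P.eval (-x c) = 0 := by
    intro c hcA
    obtain ⟨B, hc, rfl⟩ : ∃ B, c ∉ B ∧ insert c B = A :=
      ⟨A.erase c, notMem_erase c A, insert_erase hcA⟩
    have hxc : ∀ j ∈ B, x c ^ 2 - x j ^ 2 ≠ 0 := fun j hj =>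
      hx c (by simp) j (by simp [hj]) fun h => hc (h ▸ hj)
    rw [hev, hev]
    refine ⟨sum_eval_self b x hc hxc (fun _ => 1) (fun _ => -1) (by simp), ?_⟩
    rw [sum_eval_neg b x hc hxc (fun _ => 1) (fun _ => -1)]
    rcases B.eq_empty_or_nonempty with rfl | hB
    · simp
    · have hK := ih B ((ssubset_insert hc).trans (ssubset_insert ha)) hB
        (fun i hi => h0 i (by simp [hi]))
        (fun i hi j hj => hx i (by simp [hi]) j (by simp [hj]))
      simp [hK]
  have hcard : 0 < #A := hAne.card_pos
  have hP : P = 0 := by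
    refine eq_zero_of_eval_signed (A := A) (x := x) (fun i hi => h0 i (by simp [hi]))
      (fun i hi j hj => hx i (by simp [hi]) j (by simp [hj]))
      (fun c hc => (hroots c hc).1) (fun c hc => (hroots c hc).2) (Or.inl ?_)
    refine natDegree_lt_of_coeff_eq_zero ?_ (by omega) ?_
    · refine Polynomial.natDegree_sum_le_of_forall_le _ _ fun S _ => ?_
      refine (Polynomial.natDegree_C_mul_le _ _).trans ((Polynomial.natDegree_sub_le _ _).trans ?_)
      rw [(outPoly_coeff b x A S).1, (inPoly_coeff b x A S).1, max_self]
    · simp [P, (outPoly_coeff b x A _).2.1,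
        (inPoly_coeff b x A _).2.1]
  have := hev (x a)
  rw [hP, Polynomial.eval_zero] at this
  rw [this]
  exact sum_congr rfl fun S _ => by ring

/-- The polynomial `u + v X + w X²`. -/
noncomputable def quadPoly (u v w : ℂ) : Polynomial ℂ :=
  Polynomial.C u + Polynomial.C v * Polynomial.X + Polynomial.C w * Polynomial.X ^ 2

lemma quadPoly_eval (u v w t : ℂ) : (quadPoly u v w).eval t = u + v * t + w * t ^ 2 := by
  simp [quadPoly]

lemma quadPoly_natDegree_le (u v w : ℂ) : (quadPoly u v w).natDegree ≤ 2 := by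
  unfold quadPoly
  compute_degree

lemma coeff_mul_quadPoly (P : Polynomial ℂ) (u v w : ℂ) (k : ℕ) :
    (P * quadPoly u v w).coeff (k + 2) =
      u * P.coeff (k + 2) + v * P.coeff (k + 1) + w * P.coeff k := by
  have h : P * quadPoly u v w = Polynomial.C u * P + Polynomial.C v * (P * Polynomial.X)
      + Polynomial.C w * (P * Polynomial.X ^ 2) := by
    unfold quadPoly; ring
  rw [h]
  simp only [Polynomial.coeff_add, Polynomial.coeff_C_mul, Polynomial.coeff_mul_X_pow]
  rw [show k + 2 = (k + 1) + 1 from rfl, Polynomial.coeff_mul_X]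

/-- The part of `X * fieldKernel x (insert a A) S`, with `X = x a`, that is odd in the sign
of `a`. -/
noncomputable def kernelOdd (x : ι → ℂ) (A : Finset ι) : Polynomial ℂ :=
  quadPoly (∑ i ∈ A, x i) (2 * (∑ i ∈ A, x i) * ∑ i ∈ A, (x i)⁻¹) (∑ i ∈ A, (x i)⁻¹)

/-- The part of `X * fieldKernel x (insert a A) S`, with `X = x a`, that is even in the sign
of `a`. -/
noncomputable def kernelEven (x : ι → ℂ) (A S : Finset ι) : Polynomial ℂ :=
  quadPoly
    (2 * (∑ i ∈ A, x i) * (∑ i ∈ A, subsetSign S i) - ∑ i ∈ A, subsetSign S i * x i)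
    (2 * (∑ i ∈ A, subsetSign S i) + fieldKernel x A S)
    (2 * (∑ i ∈ A, (x i)⁻¹) * (∑ i ∈ A, subsetSign S i) - ∑ i ∈ A, subsetSign S i * (x i)⁻¹)

lemma mul_fieldKernel_insert (x : ι → ℂ) {A S : Finset ι} {a : ι} (ha : a ∉ A) (hS : S ⊆ A)
    (h0 : x a ≠ 0) :
    x a * fieldKernel x (insert a A) S = (kernelEven x A S + kernelOdd x A).eval (x a) := by
  have hs := subsetSign_of_notMem fun h => ha (hS h)
  simp only [fieldKernel, kernelEven, kernelOdd, Polynomial.eval_add, quadPoly_eval,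
    sum_insert ha, hs]
  field_simp
  ring

lemma sum_subsetSign_insert_one {B : Finset ι} {c : ι} (hc : c ∉ B) (S : Finset ι) :
    ∑ i ∈ B, subsetSign (insert c S) i = ∑ i ∈ B, subsetSign S i := by
  simpa using sum_subsetSign_insert hc S fun _ => 1

lemma mul_fieldKernel_insert_insert (x : ι → ℂ) {A : Finset ι} (S : Finset ι) {a : ι}
    (ha : a ∉ A) (h0 : x a ≠ 0) :
    x a * fieldKernel x (insert a A) (insert a S) =
      (kernelEven x A S - kernelOdd x A).eval (x a) := by
  simp only [fieldKernel, kernelEven, kernelOdd, Polynomial.eval_sub, quadPoly_eval,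
    sum_insert ha, subsetSign_insert_self, sum_subsetSign_insert ha,
    sum_subsetSign_insert_one ha]
  field_simp
  ring

lemma kernel_eval_self (x : ι → ℂ) {B S : Finset ι} {c : ι} (hc : c ∉ B) (hS : S ⊆ B)
    (h0 : x c ≠ 0) :
    (kernelEven x (insert c B) (insert c S) + kernelOdd x (insert c B)).eval (x c)
      + (kernelOdd x (insert c B) - kernelEven x (insert c B) S).eval (x c) = 0 := by
  have hs := subsetSign_of_notMem fun h => hc (hS h)
  simp only [fieldKernel, kernelEven, kernelOdd, Polynomial.eval_sub, Polynomial.eval_add,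
    quadPoly_eval, sum_insert hc, subsetSign_insert_self, sum_subsetSign_insert hc,
    sum_subsetSign_insert_one hc, hs]
  field_simp
  ring

lemma kernel_eval_neg_left (x : ι → ℂ) {B : Finset ι} (S : Finset ι) {c : ι} (hc : c ∉ B)
    (h0 : x c ≠ 0) :
    (kernelEven x (insert c B) (insert c S) + kernelOdd x (insert c B)).eval (-x c) =
      -2 * (x c ^ 2 * (∑ i ∈ B, (x i)⁻¹) + ∑ i ∈ B, x i) - x c * fieldKernel x B S := by
  simp only [fieldKernel, kernelEven, kernelOdd, Polynomial.eval_add,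
    quadPoly_eval, sum_insert hc, subsetSign_insert_self, sum_subsetSign_insert hc,
    sum_subsetSign_insert_one hc]
  field_simp
  ring

lemma kernel_eval_neg_right (x : ι → ℂ) {B S : Finset ι} {c : ι} (hc : c ∉ B) (hS : S ⊆ B)
    (h0 : x c ≠ 0) :
    (kernelOdd x (insert c B) - kernelEven x (insert c B) S).eval (-x c) =
      -2 * (x c ^ 2 * (∑ i ∈ B, (x i)⁻¹) + ∑ i ∈ B, x i) + x c * fieldKernel x B S := by
  have hs := subsetSign_of_notMem fun h => hc (hS h)
  simp only [fieldKernel, kernelEven, kernelOdd, Polynomial.eval_sub,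
    quadPoly_eval, sum_insert hc, hs]
  field_simp
  ring

lemma outPoly_add_inPoly_coeff (b : ℂ) (x : ι → ℂ) (A S : Finset ι) (hA : 0 < #A) :
    (outPoly b x A S).coeff (2 * #A - 1) + (inPoly b x A S).coeff (2 * #A - 1) =
      b * ∑ i ∈ A, subsetSign S i * x i := by
  rw [(outPoly_coeff b x A S).2.2 hA, (inPoly_coeff b x A S).2.2 hA, ← sum_add_distrib, mul_sum]
  refine sum_congr rfl fun i _ => ?_
  unfold subsetSign
  split_ifs <;> ring

lemma outPoly_sub_inPoly_coeff (b : ℂ) (x : ι → ℂ) (A S : Finset ι) (hA : 0 < #A) :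
    (outPoly b x A S).coeff (2 * #A - 1) - (inPoly b x A S).coeff (2 * #A - 1) =
      -(b * ∑ i ∈ A, x i) := by
  rw [(outPoly_coeff b x A S).2.2 hA, (inPoly_coeff b x A S).2.2 hA, ← sum_sub_distrib, mul_sum,
    ← sum_neg_distrib]
  refine sum_congr rfl fun i _ => ?_
  split_ifs <;> ring

lemma outPoly_eval_zero_eq_inPoly_eval_zero (b : ℂ) (x : ι → ℂ) (A S : Finset ι) :
    (outPoly b x A S).eval 0 = ∏ j ∈ A, -(x j) ^ 2 ∧
      (inPoly b x A S).eval 0 = ∏ j ∈ A, -(x j) ^ 2 := by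
  simp [outPoly, inPoly, Polynomial.eval_prod]

theorem sum_pairWeight_mul_fieldKernel (b : ℂ) (x : ι → ℂ) (A : Finset ι)
    (h0 : ∀ i ∈ A, x i ≠ 0) (hx : ∀ i ∈ A, ∀ j ∈ A, i ≠ j → x i ^ 2 - x j ^ 2 ≠ 0) :
    ∑ S ∈ A.powerset, pairWeight b x A S * fieldKernel x A S = 0 := by
  induction A using Finset.strongInduction with
  | H A ih =>
  rcases A.eq_empty_or_nonempty with rfl | ⟨a, haA⟩
  · simp [fieldKernel]
  obtain ⟨A, ha, rfl⟩ : ∃ A', a ∉ A' ∧ insert a A' = A :=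
    ⟨A.erase a, notMem_erase a A, insert_erase haA⟩
  have ha0 : x a ≠ 0 := h0 a haA
  have h0A : ∀ i ∈ A, x i ≠ 0 := fun i hi => h0 i (mem_insert_of_mem hi)
  have hxA : ∀ i ∈ A, ∀ j ∈ A, i ≠ j → x i ^ 2 - x j ^ 2 ≠ 0 := fun i hi j hj =>
    hx i (mem_insert_of_mem hi) j (mem_insert_of_mem hj)
  have hxa : ∀ j ∈ A, x a ^ 2 - x j ^ 2 ≠ 0 := fun j hj =>
    hx a haA j (mem_insert_of_mem hj) fun h => ha (h ▸ hj)
  let P : Polynomial ℂ := ∑ S ∈ A.powerset, Polynomial.C (pairWeight b x A S) *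
    (outPoly b x A S * (kernelEven x A S + kernelOdd x A)
      + inPoly b x A S * (kernelOdd x A - kernelEven x A S))
  have hev : ∀ t, P.eval t = ∑ S ∈ A.powerset, pairWeight b x A S *
      ((outPoly b x A S).eval t * (kernelEven x A S + kernelOdd x A).eval t
        + (inPoly b x A S).eval t * (kernelOdd x A - kernelEven x A S).eval t) := fun t => by
    simp only [P, Polynomial.eval_finsetSum, Polynomial.eval_mul, Polynomial.eval_C,
      Polynomial.eval_add (p := _ * _)]
  suffices hP : P = 0 by
    have key := prod_mul_sum_powerset_insert b x ha hxa (fieldKernel x (insert a A))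
    refine (mul_eq_zero.1 (?_ : (x a * ∏ j ∈ A, (x a ^ 2 - x j ^ 2)) * _ = 0)).resolve_left
      (mul_ne_zero ha0 (prod_ne_zero_iff.2 hxa))
    rw [mul_assoc, key, mul_sum]
    have hPa := hev (x a)
    rw [hP, Polynomial.eval_zero] at hPa
    rw [hPa]
    refine sum_congr rfl fun S hS => ?_
    have h1 := mul_fieldKernel_insert x ha (mem_powerset.1 hS) ha0
    have h2 := mul_fieldKernel_insert_insert x S ha ha0
    simp only [Polynomial.eval_add, Polynomial.eval_sub] at h1 h2 ⊢
    linear_combination pairWeight b x A S * (outPoly b x A S).eval (x a) * h1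
      - pairWeight b x A S * (inPoly b x A S).eval (x a) * h2
  rcases A.eq_empty_or_nonempty with rfl | hAne
  · simp [P, kernelEven, kernelOdd, quadPoly, fieldKernel]
  have hK := sum_pairWeight_eq_zero b x A hAne h0A hxA
  have hF := ih A (ssubset_insert ha) h0A hxA
  have hroots : ∀ c ∈ A, P.eval (x c) = 0 ∧ P.eval (-x c) = 0 := by
    intro c hcA
    obtain ⟨B, hc, rfl⟩ : ∃ B, c ∉ B ∧ insert c B = A :=
      ⟨A.erase c, notMem_erase c A, insert_erase hcA⟩
    have hc0 := h0A c hcA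
    have h0B : ∀ i ∈ B, x i ≠ 0 := fun i hi => h0A i (mem_insert_of_mem hi)
    have hxB : ∀ i ∈ B, ∀ j ∈ B, i ≠ j → x i ^ 2 - x j ^ 2 ≠ 0 := fun i hi j hj =>
      hxA i (mem_insert_of_mem hi) j (mem_insert_of_mem hj)
    have hxc : ∀ j ∈ B, x c ^ 2 - x j ^ 2 ≠ 0 := fun j hj =>
      hxA c hcA j (mem_insert_of_mem hj) fun h => hc (h ▸ hj)
    have hFB := ih B ((ssubset_insert hc).trans (ssubset_insert ha)) h0B hxB
    rw [hev, hev]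
    refine ⟨sum_eval_self b x hc hxc
      (fun S => (kernelEven x (insert c B) S + kernelOdd x (insert c B)).eval (x c))
      (fun S => (kernelOdd x (insert c B) - kernelEven x (insert c B) S).eval (x c))
      fun S hS => kernel_eval_self x hc hS hc0, ?_⟩
    obtain ⟨k, hk⟩ : ∃ k, k = -2 * (x c ^ 2 * (∑ i ∈ B, (x i)⁻¹) + ∑ i ∈ B, x i) := ⟨_, rfl⟩
    have hKB : (∑ S ∈ B.powerset, pairWeight b x B S) * k = 0 := by
      rcases B.eq_empty_or_nonempty with rfl | hB
      · simp [hk]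
      · rw [sum_pairWeight_eq_zero b x B hB h0B hxB, zero_mul]
    have hlin : ∀ r : ℂ, ∑ S ∈ B.powerset, pairWeight b x B S * (k + r * fieldKernel x B S) = 0 := by
      intro r
      have h : ∑ S ∈ B.powerset, pairWeight b x B S * (k + r * fieldKernel x B S) =
          (∑ S ∈ B.powerset, pairWeight b x B S) * k
            + r * ∑ S ∈ B.powerset, pairWeight b x B S * fieldKernel x B S := by
        rw [sum_mul, mul_sum, ← sum_add_distrib]
        exact sum_congr rfl fun S _ => by ring
      rw [h, hKB, hFB, mul_zero, add_zero]
    have hq : ∑ S ∈ B.powerset, pairWeight b x B S *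
        (kernelOdd x (insert c B) - kernelEven x (insert c B) S).eval (-x c) = 0 := by
      refine Eq.trans (sum_congr rfl fun S hS => ?_) (hlin (x c))
      rw [kernel_eval_neg_right x hc (mem_powerset.1 hS) hc0, hk]
    have hp : ∑ S ∈ B.powerset, pairWeight b x B S *
        (kernelEven x (insert c B) (insert c S) + kernelOdd x (insert c B)).eval (-x c) = 0 := by
      refine Eq.trans (sum_congr rfl fun S _ => ?_) (hlin (-x c))
      rw [kernel_eval_neg_left x S hc hc0, hk]
      ring
    rw [sum_eval_neg b x hc hxc
      (fun S => (kernelEven x (insert c B) S + kernelOdd x (insert c B)).eval (-x c))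
      (fun S => (kernelOdd x (insert c B) - kernelEven x (insert c B) S).eval (-x c)), hq, hp]
    ring
  have hzero : P.eval 0 = 0 := by
    rw [hev]
    refine Eq.trans (sum_congr rfl fun S _ => ?_) (show ∑ S ∈ A.powerset, pairWeight b x A S *
      ((∏ j ∈ A, -(x j) ^ 2) * (2 * ∑ i ∈ A, x i)) = 0 by rw [← sum_mul, hK, zero_mul])
    rw [(outPoly_eval_zero_eq_inPoly_eval_zero b x A S).1,
      (outPoly_eval_zero_eq_inPoly_eval_zero b x A S).2, Polynomial.eval_add,
      Polynomial.eval_sub, kernelOdd, quadPoly_eval]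
    ring
  have hcard : 0 < #A := hAne.card_pos
  have hdeg : P.natDegree ≤ 2 * #A + 2 := by
    refine Polynomial.natDegree_sum_le_of_forall_le _ _ fun S _ => ?_
    refine (Polynomial.natDegree_C_mul_le _ _).trans (Polynomial.natDegree_add_le_of_degree_le ?_ ?_)
    · exact Polynomial.natDegree_mul_le_of_le (outPoly_coeff b x A S).1.le
        (Polynomial.natDegree_add_le_of_degree_le (quadPoly_natDegree_le _ _ _)
          (quadPoly_natDegree_le _ _ _))
    · exact Polynomial.natDegree_mul_le_of_le (inPoly_coeff b x A S).1.le
        (Polynomial.natDegree_sub_le_of_le (quadPoly_natDegree_le _ _ _)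
          (quadPoly_natDegree_le _ _ _))
  have hcoeff : ∀ k, P.coeff (k + 2) = ∑ S ∈ A.powerset, pairWeight b x A S *
      (((outPoly b x A S + inPoly b x A S) * kernelOdd x A).coeff (k + 2)
        + ((outPoly b x A S - inPoly b x A S) * kernelEven x A S).coeff (k + 2)) := fun k => by
    simp only [P, Polynomial.finsetSum_coeff, Polynomial.coeff_C_mul]
    refine sum_congr rfl fun S _ => ?_
    rw [← Polynomial.coeff_add]
    congr 2
    ring
  have hhigh : ∀ S k, (outPoly b x A S).coeff (2 * #A + (k + 1)) = 0 ∧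
      (inPoly b x A S).coeff (2 * #A + (k + 1)) = 0 := fun S k =>
    ⟨Polynomial.coeff_eq_zero_of_natDegree_lt (by rw [(outPoly_coeff b x A S).1]; omega),
      Polynomial.coeff_eq_zero_of_natDegree_lt (by rw [(inPoly_coeff b x A S).1]; omega)⟩
  have htop : P.coeff (2 * #A + 2) = 0 := by
    rw [hcoeff]
    refine Eq.trans (sum_congr rfl fun S _ => ?_) (show ∑ S ∈ A.powerset, pairWeight b x A S *
      (2 * ∑ i ∈ A, (x i)⁻¹) = 0 by rw [← sum_mul, hK, zero_mul])
    rw [kernelOdd, kernelEven, coeff_mul_quadPoly, coeff_mul_quadPoly]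
    simp only [Polynomial.coeff_add, Polynomial.coeff_sub, (outPoly_coeff b x A S).2.1,
      (inPoly_coeff b x A S).2.1, hhigh S 0, hhigh S 1]
    ring
  have hnext : P.coeff (2 * #A + 1) = 0 := by
    have hidx : 2 * #A + 1 = (2 * #A - 1) + 2 := by omega
    rw [hidx, hcoeff]
    refine Eq.trans (sum_congr rfl fun S _ => ?_) (show ∑ S ∈ A.powerset,
      (pairWeight b x A S * (4 * (∑ i ∈ A, x i) * ∑ i ∈ A, (x i)⁻¹)
        - b * (pairWeight b x A S * fieldKernel x A S)) = 0 by
      rw [sum_sub_distrib, ← sum_mul, ← mul_sum, hK, hF]; ring)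
    rw [kernelOdd, kernelEven, coeff_mul_quadPoly, coeff_mul_quadPoly]
    have e1 : (2 * #A - 1) + 2 = 2 * #A + (0 + 1) := by omega
    have e2 : (2 * #A - 1) + 1 = 2 * #A := by omega
    simp only [e1, e2, Polynomial.coeff_add, Polynomial.coeff_sub, (outPoly_coeff b x A S).2.1,
      (inPoly_coeff b x A S).2.1, hhigh S 0, outPoly_add_inPoly_coeff b x A S hcard,
      outPoly_sub_inPoly_coeff b x A S hcard, fieldKernel]
    ring
  have hlt : P.natDegree < 2 * #A + 2 := natDegree_lt_of_coeff_eq_zero hdeg (by omega) htop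
  exact eq_zero_of_eval_signed h0A hxA (fun c hc => (hroots c hc).1) (fun c hc => (hroots c hc).2)
    (Or.inr ⟨hzero, natDegree_lt_of_coeff_eq_zero (by omega) (by omega) hnext⟩)

end SubsetSums

/-- For a symmetric pair function, the product over ordered pairs `i < j` with exactly one of the
two in `S` is the product over `i ∉ S`, `j ∈ S`. -/
lemma prod_prod_lt_eq_prod_sdiff {n : ℕ} (S : Finset (Fin n)) (f : Fin n → Fin n → ℂ)
    (hf : ∀ i j, f i j = f j i) (hone : ∀ i j, (i ∈ S ↔ j ∈ S) → f i j = 1) :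
    (∏ i : Fin n, ∏ j : Fin n, if (i : ℕ) < (j : ℕ) then f i j else 1) =
      ∏ i ∈ univ \ S, ∏ j ∈ S, f i j := by
  let g : Fin n → Fin n → ℂ := fun i j => if i < j ∧ i ∉ S ∧ j ∈ S then f i j else 1
  let h : Fin n → Fin n → ℂ := fun i j => if j < i ∧ i ∉ S ∧ j ∈ S then f i j else 1
  have h1 : (∏ i : Fin n, ∏ j : Fin n, if (i : ℕ) < (j : ℕ) then f i j else 1) =
      (∏ i, ∏ j, g i j) * ∏ j, ∏ i, h i j := by
    rw [← prod_mul_distrib]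
    refine prod_congr rfl fun i _ => ?_
    rw [← prod_mul_distrib]
    refine prod_congr rfl fun j _ => ?_
    have hs := hf i j
    simp only [g, h, Fin.lt_def]
    split_ifs <;> simp_all
    exact hone i j (by tauto)
  have h2 : ∏ i ∈ univ \ S, ∏ j ∈ S, f i j = ∏ i, ∏ j, g i j * h i j := by
    rw [prod_sdiff_eq_prod_ite]
    refine prod_congr rfl fun i _ => ?_
    split_ifs with hi
    · exact (prod_eq_one fun j _ => by simp [g, h, hi]).symm
    · rw [prod_eq_prod_ite_of_subset (subset_univ S)]
      refine prod_congr rfl fun j _ => ?_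
      by_cases hj : j ∈ S
      · have hij : i ≠ j := fun e => hi (e ▸ hj)
        rcases lt_or_gt_of_ne hij with hlt | hlt
        · simp [g, h, hi, hj, hlt, hlt.not_gt]
        · simp [g, h, hi, hj, hlt, hlt.not_gt]
      · simp [g, h, hj]
  rw [h1, h2, prod_comm (f := fun j i => h i j)]
  simp only [prod_mul_distrib]

/-- The occupation vector of a subset. -/
def occupation {n : ℕ} (S : Finset (Fin n)) (i : Fin n) : Fin 2 := if i ∈ S then 1 else 0

lemma neg_one_pow_occupation {n : ℕ} (S : Finset (Fin n)) (i : Fin n) :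
    (-1 : ℂ) ^ (occupation S i : ℕ) = subsetSign S i := by
  unfold occupation subsetSign
  split_ifs <;> simp

lemma sum_occupation {n : ℕ} (S : Finset (Fin n)) : ∑ i, (occupation S i : ℕ) = #S := by
  have : ∀ i, (occupation S i : ℕ) = if i ∈ S then 1 else 0 := fun i => by
    unfold occupation; split_ifs <;> rfl
  simp [this]

lemma sum_occupation_eq {n : ℕ} (F : (Fin n → Fin 2) → ℂ) :
    ∑ l, F l = ∑ S ∈ (univ : Finset (Fin n)).powerset, F (occupation S) := by
  refine sum_bij' (fun l _ => ({i | l i = 1} : Finset (Fin n))) (fun S _ => occupation S)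
    (by simp) (by simp) ?_ ?_ ?_
  · intro l _
    funext i
    simp only [occupation, mem_filter, mem_univ, true_and]
    split_ifs <;> omega
  · intro S _
    ext i
    simp [occupation]
  · intro l _
    congr 1
    funext i
    simp only [occupation, mem_filter, mem_univ, true_and]
    split_ifs <;> omega

lemma sinh_sub_eq (u v : ℂ) :
    Complex.sinh (u - v) = (Complex.exp u ^ 2 - Complex.exp v ^ 2)
      / (2 * Complex.exp u * Complex.exp v) := by
  have hu := Complex.exp_ne_zero u
  have hv := Complex.exp_ne_zero v
  rw [Complex.sinh, neg_sub, Complex.exp_sub, Complex.exp_sub]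
  field_simp

lemma Kfun_eq_sum_powerset (ν : ℝ) {n : ℕ} (p : (Fin n → ℂ) → (Fin n → Fin 2) → ℂ)
    (θ : Fin n → ℂ) :
    Kfun ν p θ = ∑ S ∈ (univ : Finset (Fin n)).powerset,
      pairWeight (2 * Complex.I * (Real.sin (Real.pi * ν) : ℂ)) (fun i => Complex.exp (θ i))
        univ S * p θ (occupation S) := by
  rw [Kfun, sum_occupation_eq]
  refine sum_congr rfl fun S _ => ?_
  rw [sum_occupation, pairWeight, prod_prod_lt_eq_prod_sdiff S (fun i j =>
    1 + (((occupation S i : ℕ) : ℂ) - ((occupation S j : ℕ) : ℂ)) * Complex.I *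
          (Real.sin (Real.pi * ν) : ℂ) / Complex.sinh (θ i - θ j))]
  · congr 2
    refine prod_congr rfl fun i hi => prod_congr rfl fun j hj => ?_
    have hi' : i ∉ S := by simpa using hi
    simp only [occupation, hi', hj, if_true, if_false, sinh_sub_eq]
    rw [div_div_eq_mul_div]
    simp
    ring
  · intro i j
    rw [← neg_sub (θ j), Complex.sinh_neg, div_neg]
    ring
  · intro i j hij
    simp [occupation, hij]

lemma exp_field_shift (ν : ℝ) (u s : ℂ) (hs : s = 1 ∨ s = -1) :
    Complex.exp (u - Real.pi * Complex.I / 2 * (1 - s * ν)) =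
      Complex.exp u * (Real.sin (Real.pi * ν / 2) * s - Complex.I * Real.cos (Real.pi * ν / 2)) := by
  have h : u - Real.pi * Complex.I / 2 * (1 - s * ν) =
      u + (-(Real.pi / 2 * Complex.I) + (s * (Real.pi * ν / 2)) * Complex.I) := by ring
  rw [h, Complex.exp_add, Complex.exp_add, Complex.exp_neg, Complex.exp_pi_div_two_mul_I,
    Complex.exp_mul_I, Complex.inv_I]
  push_cast
  rcases hs with rfl | rfl
  · rw [one_mul]
    linear_combination -Complex.exp u * Complex.sin (Real.pi * ν / 2) * Complex.I_sq
  · rw [neg_one_mul, Complex.cos_neg, Complex.sin_neg]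
    linear_combination Complex.exp u * Complex.sin (Real.pi * ν / 2) * Complex.I_sq

lemma exp_field_shift_neg (ν : ℝ) (u s : ℂ) (hs : s = 1 ∨ s = -1) :
    Complex.exp (-(u - Real.pi * Complex.I / 2 * (1 - s * ν))) =
      (Complex.exp u)⁻¹ *
        (Real.sin (Real.pi * ν / 2) * s + Complex.I * Real.cos (Real.pi * ν / 2)) := by
  rw [Complex.exp_neg, exp_field_shift ν u s hs, mul_inv]
  congr 1
  refine inv_eq_of_mul_eq_one_right ?_
  have h1 := Complex.sin_sq_add_cos_sq (Real.pi * ν / 2 : ℂ)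
  push_cast
  have hs2 : s ^ 2 = 1 := by rcases hs with rfl | rfl <;> norm_num
  linear_combination h1 + Complex.sin (Real.pi * ν / 2) ^ 2 * hs2
    - Complex.cos (Real.pi * ν / 2) ^ 2 * Complex.I_sq

lemma pPM_add_pPM_neg (ν : ℝ) {n : ℕ} (θ : Fin n → ℂ) (S : Finset (Fin n)) :
    pPM ν 1 θ (occupation S) + pPM ν (-1) θ (occupation S) =
      2 * (Real.sin (Real.pi * ν / 2) : ℂ) * (∑ i, Complex.exp (θ i)) *
          (∑ i, Complex.exp (-θ i)) * pN 1 θ (occupation S)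
        - (Real.sin (Real.pi * ν / 2) : ℂ)
          * fieldKernel (fun i => Complex.exp (θ i)) univ S := by
  have hs : ∀ i, subsetSign S i = 1 ∨ subsetSign S i = -1 := fun i => by
    unfold subsetSign; split_ifs <;> simp
  have h1 : ∀ i, Complex.exp (1 * (θ i - (Real.pi : ℂ) * Complex.I / 2 *
      (1 - (-1 : ℂ) ^ (occupation S i : ℕ) * (ν : ℂ)))) =
      Real.sin (Real.pi * ν / 2) * (subsetSign S i * Complex.exp (θ i))
        - Complex.I * Real.cos (Real.pi * ν / 2) * Complex.exp (θ i) := fun i => by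
    rw [one_mul, neg_one_pow_occupation, exp_field_shift ν _ _ (hs i)]
    ring
  have h2 : ∀ i, Complex.exp (-1 * (θ i - (Real.pi : ℂ) * Complex.I / 2 *
      (1 - (-1 : ℂ) ^ (occupation S i : ℕ) * (ν : ℂ)))) =
      Real.sin (Real.pi * ν / 2) * (subsetSign S i * (Complex.exp (θ i))⁻¹)
        + Complex.I * Real.cos (Real.pi * ν / 2) * (Complex.exp (θ i))⁻¹ := fun i => by
    rw [neg_one_mul, neg_one_pow_occupation, exp_field_shift_neg ν _ _ (hs i)]
    ring
  simp only [pPM, h1, h2]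
  simp only [pN, fieldKernel, sum_add_distrib, sum_sub_distrib, ← mul_sum, neg_one_pow_occupation,
    neg_neg, one_mul, neg_one_mul, pow_one, Complex.exp_neg]
  ring

/-- Lemma 2, fourth identity, eq. (4.6):
`2 sin(πν/2) (Σ_i e^{θ_i})(Σ_i e^{−θ_i}) K̃_n^{(1)}(θ) = K̃_n^{+}(θ) + K̃_n^{−}(θ)`. -/
theorem Ktilde_field_eq (ν : ℝ) (n : ℕ) (hn : 1 ≤ n)
    (θ : Fin n → ℂ) (hθ : Admissible θ) :
    2 * (Real.sin (Real.pi * ν / 2) : ℂ) *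
      (∑ i, Complex.exp (θ i)) * (∑ i, Complex.exp (-θ i)) * Kfun ν (pN 1) θ
      = Kfun ν (pPM ν 1) θ + Kfun ν (pPM ν (-1)) θ := by
  have hlt : ∀ i j : Fin n, i < j → Complex.exp (θ i) ^ 2 - Complex.exp (θ j) ^ 2 ≠ 0 :=
    fun i j hij h => hθ i j hij (by rw [sinh_sub_eq, h, zero_div])
  have key := sum_pairWeight_mul_fieldKernel (2 * Complex.I * (Real.sin (Real.pi * ν) : ℂ))
    (fun i => Complex.exp (θ i)) univ (fun i _ => Complex.exp_ne_zero _) fun i _ j _ hij => by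
      rcases lt_or_gt_of_ne hij with h | h
      · exact hlt i j h
      · exact fun h' => hlt j i h (by linear_combination -h')
  rw [Kfun_eq_sum_powerset, Kfun_eq_sum_powerset, Kfun_eq_sum_powerset, ← sum_add_distrib]
  simp only [← mul_add, pPM_add_pPM_neg]
  rw [← sub_eq_zero, mul_sum, ← sum_sub_distrib]
  refine Eq.trans (sum_congr rfl fun S _ => ?_)
    ((mul_sum _ _ (Real.sin (Real.pi * ν / 2) : ℂ)).symm.trans (by rw [key, mul_zero]))
  ring
end

section
/- (Relation between F(iπ) and the wave function renormalization constant Z^φ.) Let 0 < ν < 1 and set β² = 8πν/(1 + ν) and Z^φ = (1 + ν)·((πν/2)/sin(πν/2))·exp(−(1/π)·∫_0^{πν} (t/sin t) dt). Then the integral ∫_0^∞ (dt/t)·(cosh((1/2 + ν)t) − cosh(t/2))/(cosh(t/2)·sinh t) converges, and with F(iπ) := exp of this integral one has 1/F(iπ) = (β²/(8πν))·(sin(πν)/(πν))·Z^φ. Equivalently, F(iπ)·cos(πν/2) = exp((1/π)·∫_0^{πν} (t/sin t) dt). -/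
open MeasureTheory

open Real Set Filter Topology

theorem integral_exp_sub_exp {s : ℝ} (hs0 : 0 < s) (hs1 : s < 1) (k : ℕ) :
    IntegrableOn (fun t : ℝ => exp (-(2 * k + 1 - s) * t) - exp (-(2 * k + 1 + s) * t)) (Ioi 0) ∧
    ∫ t in Ioi (0 : ℝ), (exp (-(2 * k + 1 - s) * t) - exp (-(2 * k + 1 + s) * t)) =
      1 / (2 * k + 1 - s) - 1 / (2 * k + 1 + s) := by
  have hk : (0 : ℝ) ≤ k := k.cast_nonneg
  have h1 : -(2 * k + 1 - s) < 0 := by linarith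
  have h2 : -(2 * k + 1 + s) < 0 := by linarith
  have i1 := integrableOn_exp_mul_Ioi h1 0
  have i2 := integrableOn_exp_mul_Ioi h2 0
  refine ⟨i1.sub i2, ?_⟩
  rw [integral_sub i1 i2, integral_exp_mul_Ioi h1, integral_exp_mul_Ioi h2]
  rw [mul_zero, mul_zero, exp_zero, neg_div_neg_eq, neg_div_neg_eq]

theorem hasSum_tan {s : ℝ} (hs0 : 0 < s) (hs1 : s < 1) :
    HasSum (fun k : ℕ => 1 / (2 * k + 1 - s) - 1 / (2 * k + 1 + s)) (π / 2 * tan (π * s / 2)) := by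
  rw [hasSum_iff_tendsto_nat_of_nonneg]
  · set z : ℝ := (1 - s) / 2 with hz
    have hzmem : (z : ℂ) ∈ Complex.integerComplement := by
      rintro ⟨n, hn⟩
      have hn' : (n : ℝ) = z := by exact_mod_cast hn
      have h1 : (0 : ℝ) < n := by rw [hn', hz]; linarith
      have h2 : (n : ℝ) < 1 := by rw [hn', hz]; linarith
      norm_cast at h1 h2
      omega
    have hlim := tendsto_logDeriv_euler_cot_sub hzmem
    have hre := (Complex.continuous_re.tendsto _).comp hlim
    have hval : ((π : ℂ) * Complex.cot (π * z) - 1 / z).re = π * tan (π * s / 2) - 1 / z := by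
      have : ((π : ℂ) * Complex.cot (π * z) - 1 / z) = ((π * cot (π * z) - 1 / z : ℝ) : ℂ) := by
        push_cast; rfl
      rw [this, Complex.ofReal_re, cot_eq_cos_div_sin, tan_eq_sin_div_cos, hz,
        show π * ((1 - s) / 2) = π / 2 - π * s / 2 by ring, cos_pi_div_two_sub, sin_pi_div_two_sub]
    rw [hval] at hre
    have hpart (n : ℕ) : ∑ k ∈ Finset.range n, (1 / (2 * (k : ℝ) + 1 - s) - 1 / (2 * k + 1 + s)) =
        (1 / 2) * ((Complex.re ∘ fun n => ∑ j ∈ Finset.range n, cotTerm z j) n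
          + 1 / z - 1 / (n + z)) := by
      induction n with
      | zero => simp
      | succ n ih =>
        rw [Finset.sum_range_succ, ih]
        rw [Function.comp_apply, Function.comp_apply, Finset.sum_range_succ, Complex.add_re]
        have : cotTerm z n = ((1 / (z - (n + 1)) + 1 / (z + (n + 1)) : ℝ) : ℂ) := by
          simp [cotTerm]
        rw [this, Complex.ofReal_re]
        have hn : (0 : ℝ) ≤ n := n.cast_nonneg
        have e1 : 2 * (n : ℝ) + 1 - s = 2 * (n + z) := by rw [hz]; ring
        have e2 : 2 * (n : ℝ) + 1 + s = -2 * (z - (n + 1)) := by rw [hz]; ring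
        have n1 : (n : ℝ) + z ≠ 0 := by rw [hz]; linarith
        have n2 : z - ((n : ℝ) + 1) ≠ 0 := by rw [hz]; linarith
        have n3 : z + ((n : ℝ) + 1) ≠ 0 := by rw [hz]; linarith
        have n4 : (n : ℝ) + 1 + z ≠ 0 := by rw [hz]; linarith
        have n5 : z ≠ 0 := by rw [hz]; linarith
        rw [e1, e2]
        push_cast
        rw [add_comm z]
        field_simp
        ring
    simp_rw [hpart]
    have h0 : Tendsto (fun n : ℕ => 1 / ((n : ℝ) + z)) atTop (𝓝 0) :=
      tendsto_const_nhds.div_atTop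
        (tendsto_atTop_add_const_right _ _ tendsto_natCast_atTop_atTop)
    convert ((hre.add_const (1 / z)).sub h0).const_mul (1 / 2) using 2
    ring
  · intro k
    have hk : (0 : ℝ) ≤ k := k.cast_nonneg
    rw [sub_nonneg]
    exact one_div_le_one_div_of_le (by linarith) (by linarith)

theorem hasSum_exp_sub_exp (s : ℝ) {t : ℝ} (ht : 0 < t) :
    HasSum (fun k : ℕ => exp (-(2 * k + 1 - s) * t) - exp (-(2 * k + 1 + s) * t))
      (sinh (s * t) / sinh t) := by
  have hg := (hasSum_geometric_of_lt_one (exp_pos (-2 * t)).le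
    (by simpa using ht)).mul_left (2 * sinh (s * t) * exp (-t))
  convert! hg using 1
  · funext k
    rw [← exp_nat_mul, sinh_eq, mul_assoc, ← exp_add, mul_div_cancel₀ _ two_ne_zero, sub_mul,
      ← exp_add, ← exp_add]
    ring_nf
  · have h1 : exp (-2 * t) < 1 := by simpa using ht
    have h2 : 1 - exp (-2 * t) ≠ 0 := by linarith
    have h3 : sinh t ≠ 0 := (sinh_pos_iff.mpr ht).ne'
    rw [div_eq_iff h3, ← div_eq_mul_inv, div_mul_eq_mul_div, eq_div_iff h2]
    have : exp (-2 * t) = exp (-t) * exp (-t) := by rw [← exp_add]; ring_nf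
    have h5 : exp t * exp (-t) = 1 := by rw [← exp_add]; simp
    rw [sinh_eq t, this]
    linear_combination (-sinh (s * t)) * h5

theorem integrableOn_sinh_div_sinh {s : ℝ} (hs0 : 0 < s) (hs1 : s < 1) :
    IntegrableOn (fun t : ℝ => sinh (s * t) / sinh t) (Ioi 0) := by
  refine (integrableOn_exp_mul_Ioi (show s - 1 < 0 by linarith) 0).mono'
    (Measurable.aestronglyMeasurable (by fun_prop)) ?_
  filter_upwards [ae_restrict_mem measurableSet_Ioi] with t ht
  have ht : 0 < t := ht
  have h1 := sinh_pos_iff.mpr ht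
  have h2 : 0 ≤ sinh (s * t) := sinh_nonneg_iff.mpr (by positivity)
  rw [norm_of_nonneg (by positivity), div_le_iff₀ h1, sinh_eq, sinh_eq]
  have e1 : exp ((s - 1) * t) * exp t = exp (s * t) := by rw [← exp_add]; ring_nf
  have e2 : exp ((s - 1) * t) * exp (-t) ≤ exp (-(s * t)) := by
    rw [← exp_add]
    apply exp_le_exp.mpr
    nlinarith
  linarith

theorem integral_sinh_div_sinh {s : ℝ} (hs0 : 0 < s) (hs1 : s < 1) :
    ∫ t in Ioi (0 : ℝ), sinh (s * t) / sinh t = π / 2 * tan (π * s / 2) := by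
  have hnn (k : ℕ) : ∀ t ∈ Ioi (0 : ℝ),
      0 ≤ exp (-(2 * k + 1 - s) * t) - exp (-(2 * k + 1 + s) * t) := fun t ht => by
    have ht : 0 < t := ht
    rw [sub_nonneg]
    apply exp_le_exp.mpr
    nlinarith
  have h := hasSum_integral_of_summable_integral_norm
    (fun k => (integral_exp_sub_exp hs0 hs1 k).1) (by
      refine (hasSum_tan hs0 hs1).summable.congr fun k => ?_
      rw [← (integral_exp_sub_exp hs0 hs1 k).2]
      exact setIntegral_congr_fun measurableSet_Ioi fun t ht => (norm_of_nonneg (hnn k t ht)).symm)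
  simp_rw [fun k => (integral_exp_sub_exp hs0 hs1 k).2] at h
  rw [(hasSum_tan hs0 hs1).unique h]
  exact setIntegral_congr_fun measurableSet_Ioi fun t ht => (hasSum_exp_sub_exp s ht).tsum_eq.symm

theorem integral_rpow_mul_one_sub_rpow_neg {s : ℝ} (hs0 : -1 < s) (hs1 : s < 1) (hs : s ≠ 0) :
    ∫ x in Ioo (0 : ℝ) 1, x ^ s * (1 - x) ^ (-s) = π * s / sin (π * s) := by
  have hb := ProbabilityTheory.beta_eq_betaIntegralReal (1 + s) (1 - s) (by linarith) (by linarith)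
  have hB : Complex.betaIntegral ((1 + s : ℝ) : ℂ) ((1 - s : ℝ) : ℂ) =
      ((∫ x in Ioo (0 : ℝ) 1, x ^ s * (1 - x) ^ (-s) : ℝ) : ℂ) := by
    rw [Complex.betaIntegral, intervalIntegral.integral_of_le zero_le_one,
      integral_Ioc_eq_integral_Ioo, ← integral_complex_ofReal]
    refine setIntegral_congr_fun measurableSet_Ioo fun x hx => ?_
    simp only [Complex.ofReal_mul]
    rw [Complex.ofReal_cpow hx.1.le, Complex.ofReal_cpow (by linarith [hx.2])]
    push_cast
    ring_nf
  rw [hB, Complex.ofReal_re] at hb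
  rw [← hb, ProbabilityTheory.beta, add_comm 1 s, Gamma_add_one hs, mul_assoc,
    Gamma_mul_Gamma_one_sub, show s + 1 + (1 - s) = 2 by ring, Gamma_two]
  ring

theorem integral_exp_mul_div_cosh_sq {s : ℝ} (hs0 : -1 < s) (hs1 : s < 1) (hs : s ≠ 0) :
    ∫ t : ℝ, exp (s * t) / (4 * cosh (t / 2) ^ 2) = π * s / sin (π * s) := by
  rw [← integral_rpow_mul_one_sub_rpow_neg hs0 hs1 hs, ← range_sigmoid, ← image_univ,
    integral_image_eq_integral_abs_deriv_smul MeasurableSet.univ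
      (fun x _ => (hasDerivAt_sigmoid x).hasDerivWithinAt) sigmoid_injective.injOn,
    setIntegral_univ]
  congr 1 with t
  have h1 := sigmoid_pos t
  have h2 : 0 < 1 - sigmoid t := by linarith [sigmoid_lt_one t]
  rw [abs_of_pos (by positivity), smul_eq_mul, rpow_neg h2.le, ← div_eq_mul_inv,
    ← div_rpow h1.le h2.le]
  have h3 : sigmoid t / (1 - sigmoid t) = exp t := by
    rw [div_eq_iff h2.ne', ← sigmoid_neg, ← sigmoid_mul_rexp_neg, mul_left_comm, ← exp_add]
    simp
  have h4 : sigmoid t * (1 - sigmoid t) = 1 / (4 * cosh (t / 2) ^ 2) := by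
    rw [← sigmoid_neg, sigmoid_def, sigmoid_def, neg_neg, cosh_eq]
    have e1 : exp t = exp (t / 2) * exp (t / 2) := by rw [← exp_add]; ring_nf
    have e2 : exp (-t) = exp (-(t / 2)) * exp (-(t / 2)) := by rw [← exp_add]; ring_nf
    have e3 : exp (t / 2) * exp (-(t / 2)) = 1 := by rw [← exp_add]; simp
    have p1 := exp_pos t
    have p2 := exp_pos (-t)
    rw [← mul_inv, ← one_div]
    congr 1
    rw [e1, e2]
    linear_combination (exp (t / 2) * exp (-(t / 2)) - 1) * e3
  rw [h3, h4, ← exp_mul, mul_comm t s]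
  ring

theorem integrableOn_cosh_div_cosh_sq {s : ℝ} (hs0 : 0 < s) (hs1 : s < 1) :
    IntegrableOn (fun t : ℝ => cosh (s * t) / (2 * cosh (t / 2) ^ 2)) (Ioi 0) := by
  refine ((integrableOn_exp_mul_Ioi (show s - 1 < 0 by linarith) 0).const_mul 2).mono'
    (Measurable.aestronglyMeasurable (by fun_prop)) ?_
  filter_upwards [ae_restrict_mem measurableSet_Ioi] with t ht
  have ht : 0 < t := ht
  have h1 := cosh_pos (t / 2)
  have h2 := cosh_pos (s * t)
  rw [norm_of_nonneg (by positivity), div_le_iff₀ (by positivity)]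
  have h3 : cosh (s * t) ≤ exp (s * t) := by
    rw [cosh_eq]
    have : exp (-(s * t)) ≤ exp (s * t) := exp_le_exp.mpr (by nlinarith)
    linarith
  have h4 : exp (t / 2) / 2 ≤ cosh (t / 2) := by
    rw [cosh_eq]; linarith [exp_pos (-(t / 2))]
  have h5 : (exp (t / 2) / 2) ^ 2 ≤ cosh (t / 2) ^ 2 := by gcongr
  have e1 : exp (s * t) = exp ((s - 1) * t) * (exp (t / 2)) ^ 2 := by
    rw [← exp_nat_mul, ← exp_add]; push_cast; ring_nf
  have := exp_pos ((s - 1) * t)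
  nlinarith

theorem integral_cosh_div_cosh_sq {s : ℝ} (hs0 : 0 < s) (hs1 : s < 1) :
    ∫ t in Ioi (0 : ℝ), cosh (s * t) / (2 * cosh (t / 2) ^ 2) = π * s / sin (π * s) := by
  have hp := integral_exp_mul_div_cosh_sq (by linarith) hs1 hs0.ne'
  have hm := integral_exp_mul_div_cosh_sq (s := -s) (by linarith) (by linarith) (by linarith)
  have hne : π * s / sin (π * s) ≠ 0 := by
    have : 0 < sin (π * s) := sin_pos_of_pos_of_lt_pi (by positivity) (by nlinarith [pi_pos])
    positivity
  have hm' : π * -s / sin (π * -s) = π * s / sin (π * s) := by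
    rw [mul_neg, sin_neg, neg_div_neg_eq]
  rw [hm'] at hm
  have ip : Integrable fun t : ℝ => exp (s * t) / (4 * cosh (t / 2) ^ 2) :=
    Integrable.of_integral_ne_zero (by rwa [hp])
  have im : Integrable fun t : ℝ => exp (-s * t) / (4 * cosh (t / 2) ^ 2) :=
    Integrable.of_integral_ne_zero (by rwa [hm])
  have hadd := integral_add ip im
  rw [hp, hm] at hadd
  have habs := integral_comp_abs (f := fun t => cosh (s * t) / (2 * cosh (t / 2) ^ 2))
  have : ∫ t : ℝ, cosh (s * |t|) / (2 * cosh (|t| / 2) ^ 2) =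
      ∫ t : ℝ, (exp (s * t) / (4 * cosh (t / 2) ^ 2) + exp (-s * t) / (4 * cosh (t / 2) ^ 2)) := by
    congr 1 with t
    have h1 : cosh (s * |t|) = cosh (s * t) := by
      rw [← cosh_abs (s * t), abs_mul, abs_of_pos hs0]
    have h2 : cosh (|t| / 2) = cosh (t / 2) := by
      rw [← cosh_abs (t / 2), abs_div, abs_two]
    have h3 := (cosh_pos (t / 2)).ne'
    rw [h1, h2, cosh_eq (s * t), neg_mul]
    field_simp
    ring
  linarith

theorem sinh_half_add_mul_div {s t : ℝ} (ht : 0 < t) :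
    sinh ((1 / 2 + s) * t) / (cosh (t / 2) * sinh t) =
      sinh (s * t) / sinh t + cosh (s * t) / (2 * cosh (t / 2) ^ 2) := by
  have h1 := (sinh_pos_iff.mpr (half_pos ht)).ne'
  have h2 := (cosh_pos (t / 2)).ne'
  have h3 : sinh t = 2 * sinh (t / 2) * cosh (t / 2) := by
    rw [← sinh_two_mul]; ring_nf
  rw [show (1 / 2 + s) * t = s * t + t / 2 by ring, sinh_add, h3]
  field_simp

theorem integrableOn_sinh_half_add {s : ℝ} (hs0 : 0 < s) (hs1 : s < 1) :
    IntegrableOn (fun t : ℝ => sinh ((1 / 2 + s) * t) / (cosh (t / 2) * sinh t)) (Ioi 0) :=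
  ((integrableOn_sinh_div_sinh hs0 hs1).add (integrableOn_cosh_div_cosh_sq hs0 hs1)).congr_fun
    (fun _ ht => (sinh_half_add_mul_div ht).symm) measurableSet_Ioi

theorem integral_sinh_half_add {s : ℝ} (hs0 : 0 < s) (hs1 : s < 1) :
    ∫ t in Ioi (0 : ℝ), sinh ((1 / 2 + s) * t) / (cosh (t / 2) * sinh t) =
      π / 2 * tan (π * s / 2) + π * s / sin (π * s) := by
  rw [← integral_sinh_div_sinh hs0 hs1, ← integral_cosh_div_cosh_sq hs0 hs1,
    ← integral_add (integrableOn_sinh_div_sinh hs0 hs1) (integrableOn_cosh_div_cosh_sq hs0 hs1)]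
  exact setIntegral_congr_fun measurableSet_Ioi fun _ ht => sinh_half_add_mul_div ht

theorem intervalIntegral_sinh_half_add (ν : ℝ) {t : ℝ} (ht : 0 < t) :
    ∫ s in (0 : ℝ)..ν, sinh ((1 / 2 + s) * t) / (cosh (t / 2) * sinh t) =
      (cosh ((1 / 2 + ν) * t) - cosh (t / 2)) / (t * (cosh (t / 2) * sinh t)) := by
  have hderiv (s : ℝ) : HasDerivAt (fun s => cosh ((1 / 2 + s) * t) / t)
      (sinh ((1 / 2 + s) * t)) s := by
    have h := ((((hasDerivAt_id s).const_add (1 / 2)).mul_const t).cosh).div_const t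
    refine h.congr_deriv ?_
    simp only [id, one_mul]
    field_simp
  rw [intervalIntegral.integral_div, intervalIntegral.integral_eq_sub_of_hasDerivAt
    (fun s _ => hderiv s) (Continuous.intervalIntegrable (by fun_prop) _ _)]
  rw [← sub_div, div_div, add_zero, one_div_mul_eq_div]

theorem integrable_uncurry_sinh_half_add {ν : ℝ} (hν0 : 0 < ν) (hν1 : ν < 1) :
    Integrable (Function.uncurry fun s t : ℝ =>
      sinh ((1 / 2 + s) * t) / (cosh (t / 2) * sinh t))
      ((volume.restrict (uIoc 0 ν)).prod (volume.restrict (Ioi 0))) := by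
  have hdom : Integrable (fun p : ℝ × ℝ =>
      (1 : ℝ) * (sinh ((1 / 2 + ν) * p.2) / (cosh (p.2 / 2) * sinh p.2)))
      ((volume.restrict (uIoc 0 ν)).prod (volume.restrict (Ioi 0))) :=
    Integrable.mul_prod (f := fun _ : ℝ => (1 : ℝ))
      (g := fun t : ℝ => sinh ((1 / 2 + ν) * t) / (cosh (t / 2) * sinh t))
      (by rw [uIoc_of_le hν0.le]; simp) (integrableOn_sinh_half_add hν0 hν1)
  refine hdom.mono' (Measurable.aestronglyMeasurable
    (by unfold Function.uncurry; fun_prop)) ?_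
  rw [Measure.prod_restrict]
  filter_upwards [ae_restrict_mem (measurableSet_uIoc.prod measurableSet_Ioi)] with ⟨s, t⟩ ⟨hs, ht⟩
  have ht : 0 < t := ht
  rw [uIoc_of_le hν0.le] at hs
  have hs0 : 0 < s := hs.1
  have hsν : s ≤ ν := hs.2
  have h1 := sinh_pos_iff.mpr ht
  have h2 := cosh_pos (t / 2)
  have h3 : 0 ≤ sinh ((1 / 2 + s) * t) := sinh_nonneg_iff.mpr (by positivity)
  simp only [Function.uncurry_apply_pair, one_mul]
  rw [norm_of_nonneg (by positivity)]
  gcongr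
  exact sinh_le_sinh.mpr (by gcongr)

theorem integral_pi_div_two_mul_tan {ν : ℝ} (hν0 : 0 < ν) (hν1 : ν < 1) :
    IntervalIntegrable (fun s => π / 2 * tan (π * s / 2)) volume 0 ν ∧
    ∫ s in (0 : ℝ)..ν, π / 2 * tan (π * s / 2) = -log (cos (π * ν / 2)) := by
  have hcos (s : ℝ) (hs : s ∈ uIcc 0 ν) : 0 < cos (π * s / 2) := by
    rw [uIcc_of_le hν0.le] at hs
    apply cos_pos_of_mem_Ioo
    constructor <;> nlinarith [pi_pos, hs.1, hs.2]
  have hint : IntervalIntegrable (fun s => π / 2 * tan (π * s / 2)) volume 0 ν := by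
    apply ContinuousOn.intervalIntegrable
    simp_rw [tan_eq_sin_div_cos]
    exact continuousOn_const.mul (ContinuousOn.div (by fun_prop) (by fun_prop)
      fun s hs => (hcos s hs).ne')
  refine ⟨hint, ?_⟩
  have hderiv (s : ℝ) (hs : s ∈ uIcc 0 ν) :
      HasDerivAt (fun s => -log (cos (π * s / 2))) (π / 2 * tan (π * s / 2)) s := by
    have h := (((((hasDerivAt_id s).const_mul π).div_const 2).cos).log (hcos s hs).ne').neg
    refine h.congr_deriv ?_
    rw [tan_eq_sin_div_cos]
    simp only [id]
    ring
  rw [intervalIntegral.integral_eq_sub_of_hasDerivAt hderiv hint]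
  simp

theorem integrableOn_and_integral_cosh_sub_cosh {ν : ℝ} (hν0 : 0 < ν) (hν1 : ν < 1) :
    IntegrableOn (fun t : ℝ => (cosh ((1 / 2 + ν) * t) - cosh (t / 2)) /
      (t * (cosh (t / 2) * sinh t))) (Ioi 0) ∧
    ∫ t in Ioi (0 : ℝ), (cosh ((1 / 2 + ν) * t) - cosh (t / 2)) /
      (t * (cosh (t / 2) * sinh t)) =
      1 / π * (∫ t in (0 : ℝ)..(π * ν), t / sin t) - log (cos (π * ν / 2)) := by
  have hprod := integrable_uncurry_sinh_half_add hν0 hν1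
  have hinner := fun t (ht : t ∈ Ioi (0 : ℝ)) => intervalIntegral_sinh_half_add ν ht
  constructor
  · have h := hprod.integral_prod_right
    refine IntegrableOn.congr_fun h (fun t ht => ?_) measurableSet_Ioi
    rw [← hinner t ht, intervalIntegral.integral_of_le hν0.le, uIoc_of_le hν0.le]
    rfl
  · rw [← setIntegral_congr_fun measurableSet_Ioi hinner,
      ← intervalIntegral_integral_swap hprod]
    have hev : ∀ᵐ s : ℝ, s ∈ uIoc 0 ν →
        ∫ t in Ioi (0 : ℝ), sinh ((1 / 2 + s) * t) / (cosh (t / 2) * sinh t) =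
          π / 2 * tan (π * s / 2) + π * s / sin (π * s) := by
      refine Eventually.of_forall fun s hs => ?_
      rw [uIoc_of_le hν0.le] at hs
      exact integral_sinh_half_add hs.1 (hs.2.trans_lt hν1)
    obtain ⟨htan, htan'⟩ := integral_pi_div_two_mul_tan hν0 hν1
    have hleft : IntervalIntegrable (fun s => ∫ t in Ioi (0 : ℝ),
        sinh ((1 / 2 + s) * t) / (cosh (t / 2) * sinh t)) volume 0 ν := by
      rw [intervalIntegrable_iff]
      exact hprod.integral_prod_left
    have hsin : IntervalIntegrable (fun s => π * s / sin (π * s)) volume 0 ν := by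
      refine (hleft.sub htan).congr_ae ?_
      rw [EventuallyEq, ae_restrict_iff' measurableSet_uIoc]
      filter_upwards [hev] with s hs hmem
      rw [hs hmem]
      ring
    rw [intervalIntegral.integral_congr_ae hev, intervalIntegral.integral_add htan hsin, htan',
      intervalIntegral.integral_comp_mul_left (fun t => t / sin t) pi_ne_zero, mul_zero,
      smul_eq_mul]
    ring

/-- relation between `F(iπ)` and the wave function renormalization
constant `Z^φ`: for `0 < ν < 1`, `β² = 8πν/(1+ν)` and
`Z^φ = (1+ν)((πν/2)/sin(πν/2)) exp(−(1/π)∫_0^{πν} t/sin t dt)`, the integral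
`∫_0^∞ (dt/t)(cosh((1/2+ν)t) − cosh(t/2))/(cosh(t/2) sinh t)` converges, and with
`F(iπ) = exp` of this integral one has `1/F(iπ) = (β²/(8πν))(sin(πν)/(πν)) Z^φ`;
equivalently `F(iπ) cos(πν/2) = exp((1/π)∫_0^{πν} t/sin t dt)`. -/
theorem F_ipi_eq_Z (ν : ℝ) (hν0 : 0 < ν) (hν1 : ν < 1)
    (β2 : ℝ) (hβ2 : β2 = 8 * Real.pi * ν / (1 + ν))
    (Z : ℝ) (hZ : Z = (1 + ν) * ((Real.pi * ν / 2) / Real.sin (Real.pi * ν / 2)) *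
      Real.exp (-(1 / Real.pi) * ∫ t in (0 : ℝ)..(Real.pi * ν), t / Real.sin t)) :
    IntegrableOn
      (fun t : ℝ => (Real.cosh ((1 / 2 + ν) * t) - Real.cosh (t / 2)) /
        (t * (Real.cosh (t / 2) * Real.sinh t))) (Set.Ioi 0) ∧
    (Real.exp (∫ t in Set.Ioi (0 : ℝ),
        (Real.cosh ((1 / 2 + ν) * t) - Real.cosh (t / 2)) /
          (t * (Real.cosh (t / 2) * Real.sinh t))))⁻¹
      = β2 / (8 * Real.pi * ν) * (Real.sin (Real.pi * ν) / (Real.pi * ν)) * Z ∧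
    Real.exp (∫ t in Set.Ioi (0 : ℝ),
        (Real.cosh ((1 / 2 + ν) * t) - Real.cosh (t / 2)) /
          (t * (Real.cosh (t / 2) * Real.sinh t)))
      * Real.cos (Real.pi * ν / 2)
      = Real.exp ((1 / Real.pi) * ∫ t in (0 : ℝ)..(Real.pi * ν), t / Real.sin t) := by
  obtain ⟨hint, hval⟩ := integrableOn_and_integral_cosh_sub_cosh hν0 hν1
  have hpi := pi_pos
  have hcos : 0 < cos (π * ν / 2) := cos_pos_of_mem_Ioo ⟨by nlinarith, by nlinarith⟩
  have hsin : 0 < sin (π * ν / 2) := sin_pos_of_pos_of_lt_pi (by positivity) (by nlinarith)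
  refine ⟨hint, ?_, ?_⟩
  · rw [hval, exp_sub, exp_log hcos, inv_div, hβ2, hZ, neg_mul, exp_neg,
      show sin (π * ν) = 2 * sin (π * ν / 2) * cos (π * ν / 2) by
        rw [← sin_two_mul]; ring_nf]
    have h1 : 1 + ν ≠ 0 := by positivity
    field_simp
  · rw [hval, exp_sub, exp_log hcos, div_mul_cancel₀ _ hcos.ne']
end

section
/- (Functional equation for the two-particle form factor.) Let 0 < ν < 1/2 and let θ ∈ ℂ with Im θ ∈ (πν, π(1 − ν)). Then both defining integrals for F(θ) and F(θ + iπ) converge absolutely, sinh θ ≠ 0, and F(θ + iπ)·F(θ) = 1/(1 − i·sin(πν)/sinh θ). -/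
open MeasureTheory

/-- The integrand of the defining integral of the two-particle form factor `F(θ)`:
`(1/t)·(cosh((1/2+ν)t) − cosh(t/2))/(cosh(t/2) sinh t) · cosh(t(1 − θ/(iπ)))`. -/
noncomputable def Fintegrand (ν : ℝ) (θ : ℂ) (t : ℝ) : ℂ :=
  (((Real.cosh ((1 / 2 + ν) * t) - Real.cosh (t / 2)) /
      (t * (Real.cosh (t / 2) * Real.sinh t)) : ℝ) : ℂ) *
    Complex.cosh ((t : ℂ) * (1 - θ / ((Real.pi : ℂ) * Complex.I)))

lemma re_segment_pos {a b : ℂ} {s c : ℝ} (ha : c ≤ a.re) (hb : c ≤ b.re)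
    (hs0 : 0 ≤ s) (hs1 : s ≤ 1) : c ≤ (a + s * (b - a)).re := by
  have h : (a + s * (b - a)).re = (1 - s) * a.re + s * b.re := by simp; ring
  rw [h]
  nlinarith [mul_le_mul_of_nonneg_left ha (sub_nonneg.2 hs1), mul_le_mul_of_nonneg_left hb hs0]

lemma integrable_exp_segment {a b : ℂ} (ha : 0 < a.re) (hb : 0 < b.re) :
    Integrable (Function.uncurry fun t s : ℝ => (b - a) * Complex.exp (-(a + s * (b - a)) * t))
      ((volume.restrict (Set.Ioi 0)).prod (volume.restrict (Set.Ioc 0 1))) := by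
  set c := min a.re b.re with hc
  have hc0 : 0 < c := lt_min ha hb
  have h1 : IntegrableOn (fun t : ℝ => ‖b - a‖ * Real.exp (-c * t)) (Set.Ioi 0) :=
    (integrableOn_exp_mul_Ioi (neg_lt_zero.2 hc0) 0).const_mul _
  have h2 : IntegrableOn (fun _ : ℝ => (1 : ℝ)) (Set.Ioc 0 1) := by simp
  refine (h1.mul_prod h2).mono' ?_ ?_
  · apply Continuous.aestronglyMeasurable
    unfold Function.uncurry
    fun_prop
  · rw [Measure.prod_restrict]
    refine ae_restrict_of_forall_mem (measurableSet_Ioi.prod measurableSet_Ioc) ?_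
    rintro ⟨t, s⟩ ⟨ht, hs⟩
    simp only [Set.mem_Ioi, Set.mem_Ioc] at ht hs
    simp only [Function.uncurry, norm_mul, Complex.norm_exp, Complex.re_mul_ofReal, mul_one,
      Complex.neg_re]
    have := re_segment_pos (min_le_left a.re b.re) (min_le_right a.re b.re) hs.1.le hs.2
    gcongr

lemma integral_exp_segment (a b : ℂ) {t : ℝ} (ht : t ≠ 0) :
    ∫ s in Set.Ioc (0 : ℝ) 1, (b - a) * Complex.exp (-(a + s * (b - a)) * t) =
      (Complex.exp (-a * t) - Complex.exp (-b * t)) / t := by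
  have ht' : (t : ℂ) ≠ 0 := by exact_mod_cast ht
  rw [← intervalIntegral.integral_of_le zero_le_one,
    intervalIntegral.integral_eq_sub_of_hasDerivAt
      (f := fun s : ℝ => -(Complex.exp (-(a + s * (b - a)) * t) / t))]
  · simp
    ring
  · intro s _
    have h := ((((((hasDerivAt_id (s : ℂ)).mul_const (b - a)).const_add a).neg.mul_const
      (t : ℂ)).cexp.div_const (t : ℂ)).neg).comp_ofReal
    convert! h using 1
    simp
    field_simp
    ring
  · exact Continuous.intervalIntegrable (by fun_prop) _ _

lemma integral_div_segment {a b : ℂ} (ha : 0 < a.re) (hb : 0 < b.re) :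
    ∫ s in Set.Ioc (0 : ℝ) 1, (b - a) / (a + s * (b - a)) = Complex.log b - Complex.log a := by
  have hpos : ∀ s ∈ Set.uIcc (0 : ℝ) 1, 0 < (a + s * (b - a)).re := by
    intro s hs
    rw [Set.uIcc_of_le zero_le_one] at hs
    exact (lt_min ha hb).trans_le
      (re_segment_pos (min_le_left a.re b.re) (min_le_right a.re b.re) hs.1 hs.2)
  rw [← intervalIntegral.integral_of_le zero_le_one,
    intervalIntegral.integral_eq_sub_of_hasDerivAt
      (f := fun s : ℝ => Complex.log (a + s * (b - a)))]
  · simp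
  · intro s hs
    have h := ((((hasDerivAt_id (s : ℂ)).mul_const (b - a)).const_add a).clog
      (Or.inl (hpos s hs))).comp_ofReal
    simpa using h
  · apply ContinuousOn.intervalIntegrable
    refine ContinuousOn.div (by fun_prop) (by fun_prop) fun s hs h => ?_
    simpa [h] using hpos s hs

/-- Frullani's integral for complex exponentials, integrability part. -/
lemma integrableOn_exp_sub_exp_div {a b : ℂ} (ha : 0 < a.re) (hb : 0 < b.re) :
    IntegrableOn (fun t : ℝ => (Complex.exp (-a * t) - Complex.exp (-b * t)) / t)
      (Set.Ioi 0) := by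
  refine IntegrableOn.congr_fun (integrable_exp_segment ha hb).integral_prod_left ?_
    measurableSet_Ioi
  exact fun t ht => integral_exp_segment a b (ne_of_gt ht)

/-- Frullani's integral for complex exponentials, exponentiated. -/
lemma exp_integral_exp_sub_exp_div {a b : ℂ} (ha : 0 < a.re) (hb : 0 < b.re) :
    Complex.exp (∫ t in Set.Ioi (0 : ℝ), (Complex.exp (-a * t) - Complex.exp (-b * t)) / t) =
      b / a := by
  have h1 : ∫ t in Set.Ioi (0 : ℝ), (Complex.exp (-a * t) - Complex.exp (-b * t)) / t =
      ∫ t in Set.Ioi (0 : ℝ), ∫ s in Set.Ioc (0 : ℝ) 1,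
        (b - a) * Complex.exp (-(a + s * (b - a)) * t) :=
    setIntegral_congr_fun measurableSet_Ioi
      fun t ht => (integral_exp_segment a b (ne_of_gt ht)).symm
  have h2 : ∫ s in Set.Ioc (0 : ℝ) 1, ∫ t in Set.Ioi (0 : ℝ),
        (b - a) * Complex.exp (-(a + s * (b - a)) * t) =
      ∫ s in Set.Ioc (0 : ℝ) 1, (b - a) / (a + s * (b - a)) := by
    refine setIntegral_congr_fun measurableSet_Ioc fun s hs => ?_
    have hpos : 0 < (a + s * (b - a)).re := (lt_min ha hb).trans_le
      (re_segment_pos (min_le_left a.re b.re) (min_le_right a.re b.re) hs.1.le hs.2)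
    rw [integral_const_mul, integral_exp_mul_complex_Ioi
      (by simpa only [Complex.neg_re, neg_lt_zero] using hpos)]
    simp only [Complex.ofReal_zero, mul_zero, Complex.exp_zero, neg_div_neg_eq, mul_one_div]
  have ha0 : a ≠ 0 := fun h => by simp [h] at ha
  have hb0 : b ≠ 0 := fun h => by simp [h] at hb
  rw [h1, integral_integral_swap (integrable_exp_segment ha hb), h2,
    integral_div_segment ha hb, Complex.exp_sub, Complex.exp_log ha0, Complex.exp_log hb0]

lemma prod_range_two_mul (f : ℕ → ℂ) (N : ℕ) :
    ∏ j ∈ Finset.range (2 * N), f j =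
      (∏ n ∈ Finset.range N, f (2 * n)) * ∏ n ∈ Finset.range N, f (2 * n + 1) := by
  induction N with
  | zero => simp
  | succ N ih =>
    rw [mul_add_one, Finset.prod_range_succ, Finset.prod_range_succ, ih, Finset.prod_range_succ,
      Finset.prod_range_succ]
    ring

lemma cos_ne_zero_of_abs_re_lt {x : ℂ} (hx : |x.re| < 1) : Complex.cos (Real.pi * x / 2) ≠ 0 := by
  rw [Complex.cos_ne_zero_iff]
  intro k h
  have h2 : x = 2 * k + 1 := by
    have := Complex.ofReal_ne_zero.2 Real.pi_ne_zero
    field_simp at h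
    linear_combination h
  rw [h2] at hx
  have h3 : |(2 * k + 1 : ℝ)| < 1 := by simpa using hx
  have h4 : |2 * k + 1| < 1 := by exact_mod_cast h3
  rw [abs_lt] at h4
  omega

lemma sin_ne_zero_of_abs_re_lt {x : ℂ} (hx0 : x ≠ 0) (hx : |x.re| < 1) :
    Complex.sin (Real.pi * x) ≠ 0 := by
  rw [Complex.sin_ne_zero_iff]
  intro k h
  have h2 : x = k := by
    have := Complex.ofReal_ne_zero.2 Real.pi_ne_zero
    apply mul_left_cancel₀ this
    rw [h, mul_comm]
  rw [h2] at hx hx0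
  have h3 : |(k : ℝ)| < 1 := by simpa using hx
  have h4 : |k| < 1 := by exact_mod_cast h3
  exact hx0 (by simp [Int.abs_lt_one_iff.1 h4])

/-- Euler's product for the cosine. -/
lemma tendsto_euler_cos_prod {x : ℂ} (hx : |x.re| < 1) :
    Filter.Tendsto (fun N : ℕ => ∏ n ∈ Finset.range N, (1 - x ^ 2 / (2 * (n : ℂ) + 1) ^ 2))
      Filter.atTop (nhds (Complex.cos (Real.pi * x / 2))) := by
  rcases eq_or_ne x 0 with rfl | hx0
  · simp
  have hs : Complex.sin (Real.pi * (x / 2)) ≠ 0 := by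
    refine sin_ne_zero_of_abs_re_lt (by simpa using hx0) ?_
    rw [show (x / 2).re = x.re / 2 by simp, abs_div]
    norm_num
    linarith
  have h1 := (Complex.tendsto_euler_sin_prod x).comp
    (Filter.tendsto_id.const_mul_atTop' (two_pos : 0 < 2))
  have h2 := Complex.tendsto_euler_sin_prod (x / 2)
  have h3 := (h1.div h2 hs).mul_const (1 / 2)
  have hval : Complex.sin (Real.pi * x) / Complex.sin (Real.pi * (x / 2)) * (1 / 2) =
      Complex.cos (Real.pi * x / 2) := by
    rw [mul_div_assoc, show (Real.pi * x : ℂ) = 2 * (Real.pi * (x / 2)) by ring,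
      Complex.sin_two_mul]
    generalize (Real.pi * (x / 2) : ℂ) = u at hs ⊢
    field_simp
  rw [hval] at h3
  refine h3.congr' ?_
  filter_upwards [h2.eventually_ne hs] with N hN
  simp only [Function.comp, id, Pi.div_apply] at hN ⊢
  rw [prod_range_two_mul]
  have h4 : ∏ n ∈ Finset.range N, (1 - x ^ 2 / (((2 * n + 1 : ℕ) : ℂ) + 1) ^ 2) =
      ∏ n ∈ Finset.range N, (1 - (x / 2) ^ 2 / ((n : ℂ) + 1) ^ 2) := by
    refine Finset.prod_congr rfl fun n _ => ?_
    have : (n : ℂ) + 1 ≠ 0 := by exact_mod_cast n.succ_ne_zero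
    rw [show ((2 * n + 1 : ℕ) : ℂ) + 1 = 2 * ((n : ℂ) + 1) by push_cast; ring]
    field_simp
  rw [h4]
  have h5 := right_ne_zero_of_mul hN
  have h6 : (Real.pi : ℂ) ≠ 0 := Complex.ofReal_ne_zero.2 Real.pi_ne_zero
  push_cast
  generalize ∏ n ∈ Finset.range N, (1 - (x / 2) ^ 2 / ((n : ℂ) + 1) ^ 2) = Q at h5 ⊢
  field_simp

lemma integrableOn_cosh_sub_cosh_mul_exp_div {m x y : ℂ} (hx : |x.re| < m.re)
    (hy : |y.re| < m.re) :
    IntegrableOn (fun t : ℝ =>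
        2 * (Complex.cosh (x * t) - Complex.cosh (y * t)) * Complex.exp (-m * t) / t)
      (Set.Ioi 0) ∧
    Complex.exp (∫ t in Set.Ioi (0 : ℝ),
        2 * (Complex.cosh (x * t) - Complex.cosh (y * t)) * Complex.exp (-m * t) / t) =
      (m ^ 2 - y ^ 2) / (m ^ 2 - x ^ 2) := by
  have hx1 : 0 < (m - x).re := by simpa using (abs_lt.1 hx).2
  have hx2 : 0 < (m + x).re := by simpa using by linarith [(abs_lt.1 hx).1]
  have hy1 : 0 < (m - y).re := by simpa using (abs_lt.1 hy).2
  have hy2 : 0 < (m + y).re := by simpa using by linarith [(abs_lt.1 hy).1]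
  have i1 := integrableOn_exp_sub_exp_div hx1 hy1
  have i2 := integrableOn_exp_sub_exp_div hx2 hy2
  have heq : (fun t : ℝ =>
      2 * (Complex.cosh (x * t) - Complex.cosh (y * t)) * Complex.exp (-m * t) / t) =
      fun t : ℝ => (Complex.exp (-(m - x) * t) - Complex.exp (-(m - y) * t)) / t +
        (Complex.exp (-(m + x) * t) - Complex.exp (-(m + y) * t)) / t := by
    funext t
    have e : ∀ z : ℂ, Complex.exp (-(m - z) * t) = Complex.exp (-m * t) * Complex.exp (z * t) ∧
        Complex.exp (-(m + z) * t) = Complex.exp (-m * t) * Complex.exp (-(z * t)) := by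
      intro z
      constructor <;> rw [← Complex.exp_add] <;> ring_nf
    rw [(e x).1, (e x).2, (e y).1, (e y).2, Complex.cosh, Complex.cosh]
    ring
  rw [heq]
  refine ⟨i1.add i2, ?_⟩
  rw [integral_add i1 i2, Complex.exp_add, exp_integral_exp_sub_exp_div hx1 hy1,
    exp_integral_exp_sub_exp_div hx2 hy2, div_mul_div_comm]
  congr 1 <;> ring

lemma exp_neg_sub_exp_neg_eq_sinh (n : ℕ) (t : ℂ) :
    Complex.exp (-(2 * n * t)) - Complex.exp (-(2 * (n + 1 : ℕ) * t)) =
      2 * Complex.sinh t * Complex.exp (-(2 * n + 1) * t) := by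
  have h1 : Complex.exp (-(2 * n * t)) = Complex.exp t * Complex.exp (-(2 * n + 1) * t) := by
    rw [← Complex.exp_add]
    ring_nf
  have h2 : Complex.exp (-(2 * (n + 1 : ℕ) * t)) =
      Complex.exp (-t) * Complex.exp (-(2 * n + 1) * t) := by
    rw [← Complex.exp_add]
    push_cast
    ring_nf
  rw [h1, h2, Complex.sinh]
  ring

lemma tendsto_prod_sq_sub_div {x y : ℂ} (hx : |x.re| < 1) (hy : |y.re| < 1) :
    Filter.Tendsto (fun N : ℕ => ∏ n ∈ Finset.range N,
        ((2 * (n : ℂ) + 1) ^ 2 - y ^ 2) / ((2 * (n : ℂ) + 1) ^ 2 - x ^ 2)) Filter.atTop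
      (nhds (Complex.cos (Real.pi * y / 2) / Complex.cos (Real.pi * x / 2))) := by
  refine ((tendsto_euler_cos_prod hy).div (tendsto_euler_cos_prod hx)
    (cos_ne_zero_of_abs_re_lt hx)).congr fun N => ?_
  simp only [Pi.div_apply]
  rw [← Finset.prod_div_distrib]
  refine Finset.prod_congr rfl fun n _ => ?_
  have h : (2 * (n : ℂ) + 1) ≠ 0 := by exact_mod_cast (2 * n).succ_ne_zero
  rw [one_sub_div (pow_ne_zero 2 h), one_sub_div (pow_ne_zero 2 h),
    div_div_div_cancel_right₀ (pow_ne_zero 2 h)]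

/-- A convergent integral of hyperbolic cosines evaluated through Euler's product. -/
lemma exp_integral_cosh_div_sinh {x₁ x₂ y₁ y₂ : ℂ} (hx₁ : |x₁.re| < 1) (hx₂ : |x₂.re| < 1)
    (hy₁ : |y₁.re| < 1) (hy₂ : |y₂.re| < 1)
    (hint : IntegrableOn (fun t : ℝ => (Complex.cosh (x₁ * t) - Complex.cosh (y₁ * t) +
      (Complex.cosh (x₂ * t) - Complex.cosh (y₂ * t))) / (t * Complex.sinh t)) (Set.Ioi 0)) :
    Complex.exp (∫ t in Set.Ioi (0 : ℝ), (Complex.cosh (x₁ * t) - Complex.cosh (y₁ * t) +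
      (Complex.cosh (x₂ * t) - Complex.cosh (y₂ * t))) / (t * Complex.sinh t)) =
      Complex.cos (Real.pi * y₁ / 2) / Complex.cos (Real.pi * x₁ / 2) *
        (Complex.cos (Real.pi * y₂ / 2) / Complex.cos (Real.pi * x₂ / 2)) := by
  set H : ℝ → ℂ := fun t => (Complex.cosh (x₁ * t) - Complex.cosh (y₁ * t) +
      (Complex.cosh (x₂ * t) - Complex.cosh (y₂ * t))) / (t * Complex.sinh t) with hH
  let T : ℂ → ℂ → ℕ → ℝ → ℂ := fun x y n t =>
    2 * (Complex.cosh (x * t) - Complex.cosh (y * t)) * Complex.exp (-(2 * n + 1) * t) / t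
  have hre : ∀ n : ℕ, 1 ≤ (2 * (n : ℂ) + 1).re := fun n => by simp
  have hT : ∀ (x y : ℂ), |x.re| < 1 → |y.re| < 1 → ∀ n : ℕ,
      IntegrableOn (T x y n) (Set.Ioi 0) ∧
      Complex.exp (∫ t in Set.Ioi (0 : ℝ), T x y n t) =
        ((2 * (n : ℂ) + 1) ^ 2 - y ^ 2) / ((2 * (n : ℂ) + 1) ^ 2 - x ^ 2) :=
    fun x y hx hy n => integrableOn_cosh_sub_cosh_mul_exp_div
      (hx.trans_le (hre n)) (hy.trans_le (hre n))
  have hsum : ∀ (N : ℕ), ∀ t ∈ Set.Ioi (0 : ℝ),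
      ∑ n ∈ Finset.range N, (T x₁ y₁ n t + T x₂ y₂ n t) =
        H t * (1 - Complex.exp (-(2 * N * t))) := by
    intro N t ht
    have ht0 : (t : ℂ) ≠ 0 := Complex.ofReal_ne_zero.2 (ne_of_gt ht)
    have hs : Complex.sinh t ≠ 0 := by
      rw [← Complex.ofReal_sinh]
      exact Complex.ofReal_ne_zero.2 (Real.sinh_pos_iff.2 ht).ne'
    have h := Finset.sum_range_sub' (fun n : ℕ => Complex.exp (-(2 * n * t))) N
    simp only [Nat.cast_zero, mul_zero, zero_mul, neg_zero, Complex.exp_zero] at h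
    rw [← h, Finset.mul_sum]
    refine Finset.sum_congr rfl fun n _ => ?_
    rw [exp_neg_sub_exp_neg_eq_sinh]
    simp only [T, hH]
    field_simp
  have hlim : Filter.Tendsto
      (fun N : ℕ => ∫ t in Set.Ioi (0 : ℝ), H t * (1 - Complex.exp (-(2 * N * t))))
      Filter.atTop (nhds (∫ t in Set.Ioi (0 : ℝ), H t)) := by
    refine tendsto_integral_of_dominated_convergence (fun t => ‖H t‖) (fun N => ?_) hint.norm
      (fun N => ?_) ?_
    · exact hint.aestronglyMeasurable.mul
        (Continuous.aestronglyMeasurable (by fun_prop))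
    · refine ae_restrict_of_forall_mem measurableSet_Ioi fun t ht => ?_
      rw [norm_mul]
      refine mul_le_of_le_one_right (norm_nonneg _) ?_
      have ht' : (0 : ℝ) < t := ht
      have h1 : Real.exp (-(2 * N * t)) ≤ 1 := Real.exp_le_one_iff.2 (by simp; positivity)
      have h2 : (1 - Complex.exp (-(2 * N * t)) : ℂ) = ((1 - Real.exp (-(2 * N * t)) : ℝ) : ℂ) := by
        push_cast
        rfl
      rw [h2, Complex.norm_real, Real.norm_of_nonneg (sub_nonneg.2 h1)]
      linarith [Real.exp_pos (-(2 * N * t))]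
    · refine ae_restrict_of_forall_mem measurableSet_Ioi fun t ht => ?_
      have ht' : (0 : ℝ) < t := ht
      have h1 : Filter.Tendsto (fun N : ℕ => 2 * (N : ℝ) * t) Filter.atTop Filter.atTop :=
        (tendsto_natCast_atTop_atTop.const_mul_atTop two_pos).atTop_mul_const ht'
      have h2 := (Complex.continuous_ofReal.tendsto 0).comp
        (Real.tendsto_exp_neg_atTop_nhds_zero.comp h1)
      have h3 := (h2.const_sub 1).const_mul (H t)
      simpa using h3
  have hexp := (Complex.continuous_exp.tendsto _).comp hlim
  refine tendsto_nhds_unique hexp (((tendsto_prod_sq_sub_div hx₁ hy₁).mul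
    (tendsto_prod_sq_sub_div hx₂ hy₂)).congr fun N => ?_)
  simp only [Function.comp]
  rw [← setIntegral_congr_fun measurableSet_Ioi (hsum N), integral_finsetSum
    (f := fun n t => T x₁ y₁ n t + T x₂ y₂ n t) _
    fun n _ => (hT x₁ y₁ hx₁ hy₁ n).1.add (hT x₂ y₂ hx₂ hy₂ n).1, Complex.exp_sum,
    ← Finset.prod_mul_distrib]
  refine Finset.prod_congr rfl fun n _ => ?_
  rw [integral_add (hT x₁ y₁ hx₁ hy₁ n).1 (hT x₂ y₂ hx₂ hy₂ n).1, Complex.exp_add,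
    (hT x₁ y₁ hx₁ hy₁ n).2, (hT x₂ y₂ hx₂ hy₂ n).2]

lemma norm_cosh_ofReal_mul_le {t : ℝ} (ht : 0 ≤ t) (z : ℂ) :
    ‖Complex.cosh (t * z)‖ ≤ Real.exp (|z.re| * t) := by
  rw [Complex.cosh, norm_div, Complex.norm_ofNat, div_le_iff₀ two_pos, mul_two]
  refine (norm_add_le _ _).trans (add_le_add ?_ ?_) <;>
    rw [Complex.norm_exp, Real.exp_le_exp]
  · simpa [mul_comm] using mul_le_mul_of_nonneg_left (le_abs_self z.re) ht
  · simpa [mul_comm] using mul_le_mul_of_nonneg_left (neg_le_abs z.re) ht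

lemma sinh_mul_le_exp_mul_sinh {a t : ℝ} (ha : a ≤ 1) (ht : 0 ≤ t) :
    Real.sinh (a * t) ≤ Real.exp ((a - 1) * t) * Real.sinh t := by
  rw [Real.sinh_eq, Real.sinh_eq, mul_div_assoc', mul_sub, ← Real.exp_add, ← Real.exp_add]
  have h1 : (a - 1) * t + t = a * t := by ring
  have h2 : Real.exp ((a - 1) * t + -t) ≤ Real.exp (-(a * t)) := by
    rw [Real.exp_le_exp]
    nlinarith
  rw [h1]
  linarith

lemma sinh_le_mul_exp (x : ℝ) : Real.sinh x ≤ x * Real.exp x := by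
  have h : Real.sinh x = (1 - Real.exp (-(2 * x))) * Real.exp x / 2 := by
    rw [Real.sinh_eq, sub_mul, ← Real.exp_add]
    ring_nf
  rw [h]
  nlinarith [Real.add_one_le_exp (-(2 * x)), Real.exp_pos x]

lemma abs_form_factor_kernel_le {ν t : ℝ} (hν0 : 0 < ν) (hν1 : ν < 1) (ht : 0 < t) :
    |(Real.cosh ((1 / 2 + ν) * t) - Real.cosh (t / 2)) /
      (t * (Real.cosh (t / 2) * Real.sinh t))| ≤ 2 * ν * Real.exp ((ν - 1) * t) := by
  have hs : 0 < Real.sinh t := Real.sinh_pos_iff.2 ht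
  have hc : Real.exp (t / 2) ≤ 2 * Real.cosh (t / 2) := by
    rw [Real.cosh_eq]
    linarith [Real.exp_pos (-(t / 2))]
  have hdiff : Real.cosh ((1 / 2 + ν) * t) - Real.cosh (t / 2) =
      2 * (Real.sinh ((1 + ν) / 2 * t) * Real.sinh (ν / 2 * t)) := by
    rw [show (1 / 2 + ν) * t = (1 + ν) / 2 * t + ν / 2 * t by ring,
      show t / 2 = (1 + ν) / 2 * t - ν / 2 * t by ring, Real.cosh_add, Real.cosh_sub]
    ring
  have h1 := sinh_mul_le_exp_mul_sinh (a := (1 + ν) / 2) (by linarith) ht.le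
  have h2 := sinh_le_mul_exp (ν / 2 * t)
  have p1 : 0 ≤ Real.sinh ((1 + ν) / 2 * t) := Real.sinh_nonneg_iff.2 (by positivity)
  have p2 : 0 ≤ Real.sinh (ν / 2 * t) := Real.sinh_nonneg_iff.2 (by positivity)
  have hcp := Real.cosh_pos (t / 2)
  rw [hdiff, abs_of_nonneg (by positivity), div_le_iff₀ (by positivity)]
  have he : Real.exp (((1 + ν) / 2 - 1) * t) * Real.exp (ν / 2 * t) =
      Real.exp ((ν - 1) * t) * Real.exp (t / 2) := by
    rw [← Real.exp_add, ← Real.exp_add]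
    ring_nf
  calc 2 * (Real.sinh ((1 + ν) / 2 * t) * Real.sinh (ν / 2 * t))
      ≤ 2 * ((Real.exp (((1 + ν) / 2 - 1) * t) * Real.sinh t) *
          (ν / 2 * t * Real.exp (ν / 2 * t))) := by gcongr
    _ = ν * t * Real.sinh t * (Real.exp (((1 + ν) / 2 - 1) * t) * Real.exp (ν / 2 * t)) := by
        ring
    _ = ν * t * Real.sinh t * Real.exp ((ν - 1) * t) * Real.exp (t / 2) := by
        rw [he]
        ring
    _ ≤ ν * t * Real.sinh t * Real.exp ((ν - 1) * t) * (2 * Real.cosh (t / 2)) := by gcongr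
    _ = 2 * ν * Real.exp ((ν - 1) * t) * (t * (Real.cosh (t / 2) * Real.sinh t)) := by ring

lemma re_div_pi_mul_I (θ : ℂ) : (θ / ((Real.pi : ℂ) * Complex.I)).re = θ.im / Real.pi := by
  rw [← div_div, Complex.div_I]
  simp [Complex.div_ofReal_im]

lemma integrableOn_Fintegrand {ν : ℝ} (hν0 : 0 < ν) (hν1 : ν < 1) {θ : ℂ}
    (hθ1 : Real.pi * ν < θ.im) (hθ2 : θ.im < Real.pi * (2 - ν)) :
    IntegrableOn (Fintegrand ν θ) (Set.Ioi 0) := by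
  set z : ℂ := 1 - θ / ((Real.pi : ℂ) * Complex.I) with hz
  have hzre : |z.re| < 1 - ν := by
    have h1 : z.re = 1 - θ.im / Real.pi := by
      rw [hz, Complex.sub_re, re_div_pi_mul_I, Complex.one_re]
    have h2 : ν < θ.im / Real.pi := by
      rwa [lt_div_iff₀ Real.pi_pos, mul_comm]
    have h3 : θ.im / Real.pi < 2 - ν := by
      rwa [div_lt_iff₀ Real.pi_pos, mul_comm]
    rw [h1, abs_lt]
    constructor <;> linarith
  have hexp : IntegrableOn (fun t : ℝ => 2 * ν * Real.exp ((ν - 1 + |z.re|) * t)) (Set.Ioi 0) :=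
    (integrableOn_exp_mul_Ioi (by linarith) 0).const_mul _
  refine hexp.mono' ?_ ?_
  · unfold Fintegrand
    fun_prop
  · refine ae_restrict_of_forall_mem measurableSet_Ioi fun t ht => ?_
    rw [Fintegrand, norm_mul, Complex.norm_real, Real.norm_eq_abs, add_mul (ν - 1),
      Real.exp_add, ← mul_assoc (2 * ν)]
    exact mul_le_mul (abs_form_factor_kernel_le hν0 hν1 ht)
      (norm_cosh_ofReal_mul_le (le_of_lt ht) z) (norm_nonneg _) (by positivity)

lemma Fintegrand_add_pi_mul_I_add (ν : ℝ) (θ : ℂ) (t : ℝ) :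
    Fintegrand ν (θ + (Real.pi : ℂ) * Complex.I) t + Fintegrand ν θ t =
      (Complex.cosh ((1 / 2 + ν + (1 / 2 - θ / ((Real.pi : ℂ) * Complex.I))) * t) -
        Complex.cosh ((1 / 2 + (1 / 2 - θ / ((Real.pi : ℂ) * Complex.I))) * t) +
        (Complex.cosh ((1 / 2 + ν - (1 / 2 - θ / ((Real.pi : ℂ) * Complex.I))) * t) -
        Complex.cosh ((1 / 2 - (1 / 2 - θ / ((Real.pi : ℂ) * Complex.I))) * t))) /
          (t * Complex.sinh t) := by
  have hpi : (Real.pi : ℂ) * Complex.I ≠ 0 :=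
    mul_ne_zero (Complex.ofReal_ne_zero.2 Real.pi_ne_zero) Complex.I_ne_zero
  have hc : Complex.cosh (t / 2) ≠ 0 := by
    rw [show (t / 2 : ℂ) = ((t / 2 : ℝ) : ℂ) by push_cast; rfl, ← Complex.ofReal_cosh]
    exact Complex.ofReal_ne_zero.2 (Real.cosh_pos _).ne'
  simp only [Fintegrand, add_div, div_self hpi]
  set w : ℂ := 1 / 2 - θ / ((Real.pi : ℂ) * Complex.I) with hw
  rw [show (t * (1 - (θ / ((Real.pi : ℂ) * Complex.I) + 1)) : ℂ) = w * t - t / 2 by rw [hw]; ring,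
    show (t * (1 - θ / ((Real.pi : ℂ) * Complex.I)) : ℂ) = w * t + t / 2 by rw [hw]; ring,
    show ((1 / 2 + ν + w) * t : ℂ) = (1 / 2 + ν) * t + w * t by ring,
    show ((1 / 2 + ν - w) * t : ℂ) = (1 / 2 + ν) * t - w * t by ring,
    show ((1 / 2 + w) * t : ℂ) = t / 2 + w * t by ring,
    show ((1 / 2 - w) * t : ℂ) = t / 2 - w * t by ring]
  push_cast
  simp only [Complex.cosh_add, Complex.cosh_sub]
  field_simp
  ring

lemma cos_mul_cos_eq (a b : ℂ) :
    Complex.cos (Real.pi * (a + b) / 2) * Complex.cos (Real.pi * (a - b) / 2) =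
      (Complex.cos (Real.pi * a) + Complex.cos (Real.pi * b)) / 2 := by
  rw [show (Real.pi * a : ℂ) = Real.pi * (a + b) / 2 + Real.pi * (a - b) / 2 by ring,
    show (Real.pi * b : ℂ) = Real.pi * (a + b) / 2 - Real.pi * (a - b) / 2 by ring,
    Complex.cos_add, Complex.cos_sub]
  ring

lemma sinh_ne_zero_of_im_mem_Ioo {θ : ℂ} (h1 : 0 < θ.im) (h2 : θ.im < Real.pi) :
    Complex.sinh θ ≠ 0 := by
  intro h
  have h3 : Complex.sin (θ * Complex.I) = 0 := by rw [Complex.sin_mul_I, h, zero_mul]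
  obtain ⟨k, hk⟩ := Complex.sin_eq_zero_iff.1 h3
  have h4 : -θ.im = k * Real.pi := by simpa using congrArg Complex.re hk
  have h5 : (k : ℝ) < 0 := by nlinarith [Real.pi_pos]
  have h6 : (-1 : ℝ) < k := by nlinarith [Real.pi_pos]
  have h5' : k < 0 := by exact_mod_cast h5
  have h6' : -1 < k := by exact_mod_cast h6
  omega

/-- functional equation for the two-particle form factor: for
`0 < ν < 1/2` and `Im θ ∈ (πν, π(1 − ν))`, the defining integrals for `F(θ)` and
`F(θ + iπ)` converge absolutely, `sinh θ ≠ 0`, and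
`F(θ + iπ)·F(θ) = 1/(1 − i sin(πν)/sinh θ)`. -/
theorem F_functional_equation (ν : ℝ) (hν0 : 0 < ν) (hν1 : ν < 1 / 2)
    (θ : ℂ) (hθ1 : Real.pi * ν < θ.im) (hθ2 : θ.im < Real.pi * (1 - ν)) :
    IntegrableOn (Fintegrand ν θ) (Set.Ioi 0) ∧
    IntegrableOn (Fintegrand ν (θ + (Real.pi : ℂ) * Complex.I)) (Set.Ioi 0) ∧
    Complex.sinh θ ≠ 0 ∧
    Complex.exp (∫ t in Set.Ioi (0 : ℝ), Fintegrand ν (θ + (Real.pi : ℂ) * Complex.I) t) *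
      Complex.exp (∫ t in Set.Ioi (0 : ℝ), Fintegrand ν θ t)
      = 1 / (1 - Complex.I * (Real.sin (Real.pi * ν) : ℂ) / Complex.sinh θ) := by
  have hpi := Real.pi_pos
  have i1 : IntegrableOn (Fintegrand ν θ) (Set.Ioi 0) :=
    integrableOn_Fintegrand hν0 (by linarith) hθ1 (by nlinarith)
  have him : (θ + (Real.pi : ℂ) * Complex.I).im = θ.im + Real.pi := by simp
  have i2 : IntegrableOn (Fintegrand ν (θ + (Real.pi : ℂ) * Complex.I)) (Set.Ioi 0) :=
    integrableOn_Fintegrand hν0 (by linarith) (by rw [him]; linarith) (by rw [him]; nlinarith)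
  have hsinh : Complex.sinh θ ≠ 0 :=
    sinh_ne_zero_of_im_mem_Ioo (by nlinarith) (by nlinarith)
  refine ⟨i1, i2, hsinh, ?_⟩
  have hsum := i2.add i1
  rw [show Fintegrand ν (θ + (Real.pi : ℂ) * Complex.I) + Fintegrand ν θ = _ from
    funext (Fintegrand_add_pi_mul_I_add ν θ)] at hsum
  rw [← Complex.exp_add, ← integral_add i2 i1]
  simp only [Fintegrand_add_pi_mul_I_add]
  set w : ℂ := 1 / 2 - θ / ((Real.pi : ℂ) * Complex.I) with hw
  have hwre : w.re = 1 / 2 - θ.im / Real.pi := by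
    rw [hw, Complex.sub_re, re_div_pi_mul_I]
    norm_num
  have b1 : ν < θ.im / Real.pi := by rwa [lt_div_iff₀ hpi, mul_comm]
  have b2 : θ.im / Real.pi < 1 - ν := by rwa [div_lt_iff₀ hpi, mul_comm]
  have hp : ((1 / 2 + ν : ℂ)).re = 1 / 2 + ν := by norm_num
  have hq : ((1 / 2 : ℂ)).re = 1 / 2 := by norm_num
  have hx₁ : |((1 / 2 + ν + w : ℂ)).re| < 1 := by
    rw [Complex.add_re, hp, hwre, abs_lt]
    constructor <;> linarith
  have hx₂ : |((1 / 2 + ν - w : ℂ)).re| < 1 := by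
    rw [Complex.sub_re, hp, hwre, abs_lt]
    constructor <;> linarith
  have hy₁ : |((1 / 2 + w : ℂ)).re| < 1 := by
    rw [Complex.add_re, hq, hwre, abs_lt]
    constructor <;> linarith
  have hy₂ : |((1 / 2 - w : ℂ)).re| < 1 := by
    rw [Complex.sub_re, hq, hwre, abs_lt]
    constructor <;> linarith
  rw [exp_integral_cosh_div_sinh hx₁ hx₂ hy₁ hy₂ hsum, div_mul_div_comm]
  have hden := mul_ne_zero (cos_ne_zero_of_abs_re_lt hx₁) (cos_ne_zero_of_abs_re_lt hx₂)
  rw [cos_mul_cos_eq] at hden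
  rw [cos_mul_cos_eq, cos_mul_cos_eq]
  have hpiC : (Real.pi : ℂ) ≠ 0 := Complex.ofReal_ne_zero.2 Real.pi_ne_zero
  have hcw : Complex.cos (Real.pi * w) = -(Complex.I * Complex.sinh θ) := by
    have : (Real.pi * w : ℂ) = Real.pi / 2 + θ * Complex.I := by
      rw [hw, ← div_div, Complex.div_I]
      field_simp
      ring
    rw [this, add_comm, Complex.cos_add_pi_div_two, Complex.sin_mul_I, mul_comm]
  have hcp : Complex.cos (Real.pi * (1 / 2 + ν)) = -(Real.sin (Real.pi * ν) : ℂ) := by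
    rw [show (Real.pi * (1 / 2 + ν) : ℂ) = Real.pi * ν + Real.pi / 2 by ring,
      Complex.cos_add_pi_div_two]
    push_cast
    rfl
  have hcq : Complex.cos (Real.pi * (1 / 2)) = 0 := by
    rw [mul_one_div, Complex.cos_pi_div_two]
  rw [hcw, hcp] at hden
  rw [hcw, hcp, hcq]
  generalize (Real.sin (Real.pi * ν) : ℂ) = s at hden ⊢
  generalize Complex.sinh θ = S at hden hsinh ⊢
  have hd : S - Complex.I * s ≠ 0 := by
    intro h
    apply hden
    linear_combination (-Complex.I / 2) * h - s / 2 * Complex.I_sq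
  rw [one_sub_div hsinh, one_div_div, div_eq_div_iff hden hd]
  linear_combination (S * s / 2) * Complex.I_sq
end

section
/- (Subset-sum representation of the exponential K-function, eq. (5.11).) Let ν ∈ ℝ, q ∈ ℂ with q ≠ 0, n ≥ 1 an integer, and θ ∈ ℂ^n admissible. Then K̃_n^{(q)}(θ) = Σ_{m=0}^{n} (−1)^m · q^{n−2m} · Σ_{K ⊆ {1,…,n}, |K| = m} Π_{i ∈ {1,…,n}∖K} Π_{k ∈ K} φ̃(θ_i − θ_k), where φ̃(z) = 1 + i·sin(πν)/sinh z. -/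
open Finset

/-- p-function of the exponential operator: `p^{(q)}(θ,l) = Π_i q^{(−1)^{l_i}}`. -/
noncomputable def pq (q : ℂ) {n : ℕ} : (Fin n → ℂ) → (Fin n → Fin 2) → ℂ :=
  fun _ l => ∏ i, q ^ ((-1 : ℤ) ^ (l i : ℕ))

/-- The two-body factor `1 + c a b / (a² - b²)`; with `a = exp u`, `b = exp v` and `c = 2 d` it is
`1 + d / sinh (u - v)`. -/
def pairFactor {F : Type*} [Field F] (c a b : F) : F := 1 + c * a * b / (a ^ 2 - b ^ 2)

/-- The product of the two-body factors between `S \ K` and `K`. -/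
def subsetWeight {F ι : Type*} [Field F] [DecidableEq ι] (c : F) (x : ι → F)
    (S K : Finset ι) : F :=
  ∏ i ∈ S \ K, ∏ k ∈ K, pairFactor c (x i) (x k)

/-- The generating function of the subset weights. -/
def subsetGenFun {F ι : Type*} [Field F] [DecidableEq ι] (c z : F) (x : ι → F)
    (S : Finset ι) : F :=
  ∑ K ∈ S.powerset, z ^ #K * subsetWeight c x S K

open Polynomial in
/-- The numerator of `subsetGenFun c z x (insert a T)` as a polynomial in the variable `x a`. -/
noncomputable def numeratorPoly {F ι : Type*} [Field F] [DecidableEq ι] (c z : F) (x : ι → F)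
    (T : Finset ι) : F[X] :=
  ∑ K ∈ T.powerset, C (z ^ #K * subsetWeight c x T K) *
    ((∏ k ∈ K, (X ^ 2 + C (c * x k) * X + C (-x k ^ 2))) *
        (∏ i ∈ T \ K, (X ^ 2 + C 0 * X + C (-x i ^ 2))) +
      C z * ((∏ i ∈ T \ K, (X ^ 2 + C (-(c * x i)) * X + C (-x i ^ 2))) *
        ∏ k ∈ K, (X ^ 2 + C 0 * X + C (-x k ^ 2))))

open Polynomial in
lemma natDegree_prod_quadratic_le {F ι : Type*} [Field F] (b d : ι → F) (T : Finset ι) :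
    (∏ i ∈ T, (X ^ 2 + C (b i) * X + C (d i))).natDegree ≤ 2 * #T := by
  refine (natDegree_prod_le _ _).trans ?_
  rw [mul_comm, ← smul_eq_mul]
  refine sum_le_card_nsmul _ _ _ fun i _ => ?_
  compute_degree

section SubsetGenFun

variable {F ι : Type*} [Field F] [DecidableEq ι]

lemma pairFactor_neg_left (c a b : F) : pairFactor c (-a) b = pairFactor c b a := by
  rw [pairFactor, pairFactor, neg_sq, ← neg_sub (b ^ 2), div_neg]
  ring

lemma pairFactor_neg_right (c a b : F) : pairFactor c a (-b) = pairFactor c b a := by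
  rw [pairFactor, pairFactor, neg_sq, ← neg_sub (b ^ 2), div_neg]
  ring

lemma pairFactor_neg (c a b : F) : pairFactor (-c) a b = pairFactor c b a := by
  rw [pairFactor, pairFactor, ← neg_sub (b ^ 2), div_neg]
  ring

lemma sq_sub_sq_mul_pairFactor (c : F) {a b : F} (h : a ^ 2 - b ^ 2 ≠ 0) :
    (a ^ 2 - b ^ 2) * pairFactor c a b = a ^ 2 - b ^ 2 + c * a * b := by
  rw [pairFactor]
  field_simp

lemma sq_sub_sq_mul_pairFactor_swap (c : F) {a b : F} (h : a ^ 2 - b ^ 2 ≠ 0) :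
    (a ^ 2 - b ^ 2) * pairFactor c b a = a ^ 2 - b ^ 2 - c * a * b := by
  rw [← pairFactor_neg, sq_sub_sq_mul_pairFactor _ h]
  ring

lemma subsetWeight_insert_left (c : F) (x : ι → F) {a : ι} {T K : Finset ι} (ha : a ∉ T)
    (hK : K ⊆ T) :
    subsetWeight c x (insert a T) K =
      (∏ k ∈ K, pairFactor c (x a) (x k)) * subsetWeight c x T K := by
  have haK : a ∉ K := fun h => ha (hK h)
  rw [subsetWeight, subsetWeight, insert_sdiff_of_notMem _ haK,
    prod_insert (fun h => ha (mem_sdiff.1 h).1)]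

lemma subsetWeight_insert_insert (c : F) (x : ι → F) {a : ι} {T K : Finset ι} (ha : a ∉ T)
    (hK : K ⊆ T) :
    subsetWeight c x (insert a T) (insert a K) =
      (∏ i ∈ T \ K, pairFactor c (x i) (x a)) * subsetWeight c x T K := by
  have haK : a ∉ K := fun h => ha (hK h)
  have h : insert a T \ insert a K = T \ K := by
    ext i
    simp only [mem_sdiff, mem_insert]
    grind
  rw [subsetWeight, subsetWeight, h, ← prod_mul_distrib]
  exact prod_congr rfl fun i _ => prod_insert haK

lemma subsetGenFun_insert (c z : F) (x : ι → F) {a : ι} {T : Finset ι} (ha : a ∉ T) :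
    subsetGenFun c z x (insert a T) = ∑ K ∈ T.powerset, z ^ #K * subsetWeight c x T K *
      ((∏ k ∈ K, pairFactor c (x a) (x k)) + z * ∏ i ∈ T \ K, pairFactor c (x i) (x a)) := by
  rw [subsetGenFun, sum_powerset_insert ha, ← sum_add_distrib]
  refine sum_congr rfl fun K hK => ?_
  rw [mem_powerset] at hK
  rw [subsetWeight_insert_left c x ha hK, subsetWeight_insert_insert c x ha hK,
    card_insert_of_notMem fun h => ha (hK h)]
  ring

lemma eval_numeratorPoly (c z t : F) (x : ι → F) (T : Finset ι) :
    (numeratorPoly c z x T).eval t = ∑ K ∈ T.powerset, z ^ #K * subsetWeight c x T K *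
      ((∏ k ∈ K, (t ^ 2 - x k ^ 2 + c * t * x k)) * (∏ i ∈ T \ K, (t ^ 2 - x i ^ 2)) +
        z * ((∏ i ∈ T \ K, (t ^ 2 - x i ^ 2 - c * t * x i)) * ∏ k ∈ K, (t ^ 2 - x k ^ 2))) := by
  simp only [numeratorPoly, Polynomial.eval_finsetSum, Polynomial.eval_mul, Polynomial.eval_add,
    Polynomial.eval_prod, Polynomial.eval_pow, Polynomial.eval_X, Polynomial.eval_C]
  refine sum_congr rfl fun K _ => ?_
  congr! 4 <;> first | ring1 | (refine prod_congr rfl fun i _ => ?_; ring)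

lemma eval_numeratorPoly_eq_mul_subsetGenFun (c z : F) (x : ι → F) {a : ι} {T : Finset ι}
    (ha : a ∉ T) (h : ∀ j ∈ T, x a ^ 2 - x j ^ 2 ≠ 0) :
    (numeratorPoly c z x T).eval (x a) =
      (∏ j ∈ T, (x a ^ 2 - x j ^ 2)) * subsetGenFun c z x (insert a T) := by
  rw [eval_numeratorPoly, subsetGenFun_insert c z x ha, mul_sum]
  refine sum_congr rfl fun K hK => ?_
  rw [mem_powerset] at hK
  have h₁ : ∏ k ∈ K, (x a ^ 2 - x k ^ 2 + c * x a * x k) =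
      (∏ k ∈ K, (x a ^ 2 - x k ^ 2)) * ∏ k ∈ K, pairFactor c (x a) (x k) := by
    rw [← prod_mul_distrib]
    exact prod_congr rfl fun k hk => (sq_sub_sq_mul_pairFactor c (h k (hK hk))).symm
  have h₂ : ∏ i ∈ T \ K, (x a ^ 2 - x i ^ 2 - c * x a * x i) =
      (∏ i ∈ T \ K, (x a ^ 2 - x i ^ 2)) * ∏ i ∈ T \ K, pairFactor c (x i) (x a) := by
    rw [← prod_mul_distrib]
    exact prod_congr rfl fun i hi =>
      (sq_sub_sq_mul_pairFactor_swap c (h i (mem_sdiff.1 hi).1)).symm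
  rw [h₁, h₂, ← prod_sdiff hK]
  ring

lemma eval_zero_numeratorPoly (c z : F) (x : ι → F) (T : Finset ι) :
    (numeratorPoly c z x T).eval 0 =
      (∏ j ∈ T, (0 - x j ^ 2)) * (1 + z) * subsetGenFun c z x T := by
  rw [eval_numeratorPoly, subsetGenFun, mul_sum]
  refine sum_congr rfl fun K hK => ?_
  rw [← prod_sdiff (mem_powerset.1 hK)]
  simp only [mul_zero, zero_mul, add_zero, sub_zero, zero_pow two_ne_zero]
  ring

/-- At a point `t = ± x j` only the terms carrying the residue at `t` survive. -/
lemma eval_numeratorPoly_insert (c z t : F) (x : ι → F) {j : ι} {U : Finset ι} (hj : j ∉ U)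
    (ht : t ^ 2 = x j ^ 2) (h : ∀ u ∈ U, t ^ 2 - x u ^ 2 ≠ 0) :
    (numeratorPoly c z x (insert j U)).eval t =
      ∑ K ∈ U.powerset, z ^ (#K + 1) * subsetWeight c x U K * (c * t * x j) *
        (∏ u ∈ U, (t ^ 2 - x u ^ 2)) *
        ((∏ k ∈ K, pairFactor c t (x k)) * (∏ i ∈ U \ K, pairFactor c (x i) (x j)) -
          (∏ k ∈ K, pairFactor c (x j) (x k)) * ∏ i ∈ U \ K, pairFactor c (x i) t) := by
  rw [eval_numeratorPoly, sum_powerset_insert hj, ← sum_add_distrib]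
  refine sum_congr rfl fun K hK => ?_
  rw [mem_powerset] at hK
  have hjK : j ∉ K := fun h => hj (hK h)
  have hs : insert j U \ insert j K = U \ K := by
    ext i
    simp only [mem_sdiff, mem_insert]
    grind
  have h₁ : ∏ k ∈ K, (t ^ 2 - x k ^ 2 + c * t * x k) =
      (∏ k ∈ K, (t ^ 2 - x k ^ 2)) * ∏ k ∈ K, pairFactor c t (x k) := by
    rw [← prod_mul_distrib]
    exact prod_congr rfl fun k hk => (sq_sub_sq_mul_pairFactor c (h k (hK hk))).symm
  have h₂ : ∏ i ∈ U \ K, (t ^ 2 - x i ^ 2 - c * t * x i) =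
      (∏ i ∈ U \ K, (t ^ 2 - x i ^ 2)) * ∏ i ∈ U \ K, pairFactor c (x i) t := by
    rw [← prod_mul_distrib]
    exact prod_congr rfl fun i hi =>
      (sq_sub_sq_mul_pairFactor_swap c (h i (mem_sdiff.1 hi).1)).symm
  have hjd : j ∉ U \ K := fun h => hj (mem_sdiff.1 h).1
  rw [hs, insert_sdiff_of_notMem _ hjK, prod_insert hjd, prod_insert hjd, prod_insert hjK,
    prod_insert hjK, subsetWeight_insert_left c x hj hK, subsetWeight_insert_insert c x hj hK,
    card_insert_of_notMem hjK, h₁, h₂, ← prod_sdiff hK, ht]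
  ring

lemma eval_self_numeratorPoly (c z : F) (x : ι → F) {j : ι} {U : Finset ι} (hj : j ∉ U)
    (h : ∀ u ∈ U, x j ^ 2 - x u ^ 2 ≠ 0) :
    (numeratorPoly c z x (insert j U)).eval (x j) = 0 := by
  rw [eval_numeratorPoly_insert c z (x j) x hj rfl h]
  exact sum_eq_zero fun K _ => by rw [sub_self, mul_zero]

lemma eval_neg_numeratorPoly (c z : F) (x : ι → F) {j : ι} {U : Finset ι} (hj : j ∉ U)
    (h : ∀ u ∈ U, x j ^ 2 - x u ^ 2 ≠ 0) :
    (numeratorPoly c z x (insert j U)).eval (-x j) =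
      z * (c * -x j * x j) * (∏ u ∈ U, (x j ^ 2 - x u ^ 2)) *
        ((∏ u ∈ U, pairFactor c (x u) (x j)) - ∏ u ∈ U, pairFactor c (x j) (x u)) *
        subsetGenFun c z x U := by
  rw [eval_numeratorPoly_insert c z (-x j) x hj (neg_sq _) (by simpa only [neg_sq] using h),
    subsetGenFun, mul_sum]
  refine sum_congr rfl fun K hK => ?_
  simp only [pairFactor_neg_left, pairFactor_neg_right, neg_sq]
  rw [← prod_sdiff (mem_powerset.1 hK) (f := fun u => pairFactor c (x u) (x j)),
    ← prod_sdiff (mem_powerset.1 hK) (f := fun u => pairFactor c (x j) (x u))]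
  ring

lemma natDegree_numeratorPoly_le (c z : F) (x : ι → F) (T : Finset ι) :
    (numeratorPoly c z x T).natDegree ≤ 2 * #T := by
  refine Polynomial.natDegree_sum_le_of_forall_le _ _ fun K hK => ?_
  have hc := card_sdiff_add_card_eq_card (mem_powerset.1 hK)
  refine (Polynomial.natDegree_C_mul_le _ _).trans (Polynomial.natDegree_add_le_of_degree_le ?_ ?_)
  · refine Polynomial.natDegree_mul_le.trans ((add_le_add (natDegree_prod_quadratic_le _ _ _)
      (natDegree_prod_quadratic_le _ _ _)).trans ?_)
    omega
  · refine (Polynomial.natDegree_C_mul_le _ _).trans (Polynomial.natDegree_mul_le.trans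
      ((add_le_add (natDegree_prod_quadratic_le _ _ _)
        (natDegree_prod_quadratic_le _ _ _)).trans ?_))
    omega

lemma card_insert_zero_image_union_image_neg [CharZero F] {x : ι → F} {T : Finset ι}
    [DecidableEq F] (h₀ : ∀ i ∈ T, x i ≠ 0)
    (h : ∀ i ∈ T, ∀ j ∈ T, i ≠ j → x i ^ 2 - x j ^ 2 ≠ 0) :
    #(insert 0 (T.image x ∪ T.image fun i => -x i)) = 2 * #T + 1 := by
  have hinj : Set.InjOn x T := fun i hi j hj hij => by
    by_contra hne
    exact h i hi j hj hne (by rw [hij, sub_self])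
  have hinj' : Set.InjOn (fun i => -x i) T := fun i hi j hj hij => hinj hi hj (neg_inj.1 hij)
  rw [card_insert_of_notMem, card_union_of_disjoint, card_image_of_injOn hinj,
    card_image_of_injOn hinj']
  · ring
  · rw [disjoint_left]
    intro y hy hy'
    obtain ⟨i, hi, rfl⟩ := mem_image.1 hy
    obtain ⟨j, hj, hij⟩ := mem_image.1 hy'
    by_cases hne : j = i
    · subst hne
      exact h₀ j hj (self_eq_neg.1 hij.symm)
    · exact h j hj i hi hne (by rw [← hij, neg_sq, sub_self])
  · intro hmem
    rcases mem_union.1 hmem with hy | hy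
    · obtain ⟨i, hi, hi'⟩ := mem_image.1 hy
      exact h₀ i hi hi'
    · obtain ⟨i, hi, hi'⟩ := mem_image.1 hy
      exact h₀ i hi (neg_eq_zero.1 hi')

/-- The subset generating function is even in the coupling. -/
theorem subsetGenFun_neg [CharZero F] (c z : F) (x : ι → F) (S : Finset ι)
    (h₀ : ∀ i ∈ S, x i ≠ 0) (h : ∀ i ∈ S, ∀ j ∈ S, i ≠ j → x i ^ 2 - x j ^ 2 ≠ 0) :
    subsetGenFun (-c) z x S = subsetGenFun c z x S := by
  classical
  induction S using Finset.strongInduction with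
  | H S ih =>
  rcases S.eq_empty_or_nonempty with rfl | ⟨a, ha⟩
  · simp [subsetGenFun, subsetWeight]
  obtain ⟨T, haT, rfl⟩ : ∃ T, a ∉ T ∧ insert a T = S :=
    ⟨S.erase a, notMem_erase a S, insert_erase ha⟩
  have ih' : ∀ U ⊆ T, subsetGenFun (-c) z x U = subsetGenFun c z x U := fun U hU =>
    ih U ⟨hU.trans (subset_insert a T), fun hs => haT (hU (hs (mem_insert_self a T)))⟩
      (fun i hi => h₀ i (mem_insert_of_mem (hU hi)))
      fun i hi j hj => h i (mem_insert_of_mem (hU hi)) j (mem_insert_of_mem (hU hj))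
  have hT₀ : ∀ i ∈ T, x i ≠ 0 := fun i hi => h₀ i (mem_insert_of_mem hi)
  have hT : ∀ i ∈ T, ∀ j ∈ T, i ≠ j → x i ^ 2 - x j ^ 2 ≠ 0 := fun i hi j hj =>
    h i (mem_insert_of_mem hi) j (mem_insert_of_mem hj)
  have haj : ∀ j ∈ T, x a ^ 2 - x j ^ 2 ≠ 0 := fun j hj =>
    h a ha j (mem_insert_of_mem hj) fun e => haT (e ▸ hj)
  have hpoly : numeratorPoly (-c) z x T = numeratorPoly c z x T := by
    refine Polynomial.eq_of_degree_sub_lt_of_eval_finset_eq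
      (insert 0 (T.image x ∪ T.image fun i => -x i)) ?_ ?_
    · rw [card_insert_zero_image_union_image_neg hT₀ hT]
      refine Polynomial.degree_le_natDegree.trans_lt (Nat.cast_lt.2 (Nat.lt_succ_of_le ?_))
      exact Polynomial.natDegree_sub_le_of_le (natDegree_numeratorPoly_le _ _ _ _)
        (natDegree_numeratorPoly_le _ _ _ _) |>.trans (max_self _).le
    · have key : ∀ j ∈ T,
          (numeratorPoly (-c) z x T).eval (x j) = (numeratorPoly c z x T).eval (x j) ∧
          (numeratorPoly (-c) z x T).eval (-x j) = (numeratorPoly c z x T).eval (-x j) := by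
        intro j hj
        obtain ⟨U, hjU, rfl⟩ : ∃ U, j ∉ U ∧ insert j U = T :=
          ⟨T.erase j, notMem_erase j T, insert_erase hj⟩
        have hU : ∀ u ∈ U, x j ^ 2 - x u ^ 2 ≠ 0 := fun u hu =>
          hT j hj u (mem_insert_of_mem hu) fun e => hjU (e ▸ hu)
        refine ⟨?_, ?_⟩
        · rw [eval_self_numeratorPoly _ _ _ hjU hU, eval_self_numeratorPoly _ _ _ hjU hU]
        · rw [eval_neg_numeratorPoly _ _ _ hjU hU, eval_neg_numeratorPoly _ _ _ hjU hU,
            ih' U (subset_insert j U)]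
          simp only [pairFactor_neg]
          ring
      intro t ht
      rcases mem_insert.1 ht with rfl | ht
      · rw [eval_zero_numeratorPoly, eval_zero_numeratorPoly, ih' T Subset.rfl]
      rcases mem_union.1 ht with ht | ht
      · obtain ⟨j, hj, rfl⟩ := mem_image.1 ht
        exact (key j hj).1
      · obtain ⟨j, hj, rfl⟩ := mem_image.1 ht
        exact (key j hj).2
  have heq := congrArg (Polynomial.eval (x a)) hpoly
  rw [eval_numeratorPoly_eq_mul_subsetGenFun _ _ _ haT haj,
    eval_numeratorPoly_eq_mul_subsetGenFun _ _ _ haT haj] at heq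
  exact mul_left_cancel₀ (prod_ne_zero_iff.2 haj) heq

end SubsetGenFun

lemma exp_sq_sub_exp_sq (u v : ℂ) :
    Complex.exp u ^ 2 - Complex.exp v ^ 2 =
      2 * Complex.exp u * Complex.exp v * Complex.sinh (u - v) := by
  have hu := Complex.exp_ne_zero u
  have hv := Complex.exp_ne_zero v
  rw [Complex.sinh, neg_sub, Complex.exp_sub, Complex.exp_sub]
  field_simp

lemma pairFactor_exp (d u v : ℂ) :
    pairFactor (2 * d) (Complex.exp u) (Complex.exp v) = 1 + d / Complex.sinh (u - v) := by
  have hu := Complex.exp_ne_zero u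
  have hv := Complex.exp_ne_zero v
  rw [pairFactor, exp_sq_sub_exp_sq,
    ← mul_div_mul_left d _ (mul_ne_zero (mul_ne_zero two_ne_zero hu) hv)]
  ring

lemma prod_prod_ite_lt_mul_swap {n : ℕ} {M : Type*} [CommMonoid M] (f : Fin n → Fin n → M)
    (hf : ∀ i, f i i = 1) :
    (∏ i : Fin n, ∏ j : Fin n, if (i : ℕ) < (j : ℕ) then f i j * f j i else 1) =
      ∏ i : Fin n, ∏ j : Fin n, f i j := by
  have h₁ : ∀ i j : Fin n, (if (i : ℕ) < (j : ℕ) then f i j * f j i else 1) =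
      (if (i : ℕ) < (j : ℕ) then f i j else 1) * if (i : ℕ) < (j : ℕ) then f j i else 1 := by
    intro i j
    split_ifs <;> simp
  have h₂ : ∀ i j : Fin n, f i j =
      (if (i : ℕ) < (j : ℕ) then f i j else 1) * if (j : ℕ) < (i : ℕ) then f i j else 1 := by
    intro i j
    rcases lt_trichotomy i j with h | rfl | h
    · have h' : (i : ℕ) < (j : ℕ) := h
      simp [h', h'.le.not_gt]
    · simp [hf]
    · have h' : (j : ℕ) < (i : ℕ) := h
      simp [h', h'.le.not_gt]
  rw [prod_congr rfl fun i _ => prod_congr rfl fun j _ => h₂ i j]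
  simp only [h₁, prod_mul_distrib]
  congr 1
  exact prod_comm

lemma prod_prod_exchange_eq_subsetWeight {n : ℕ} (d : ℂ) (θ : Fin n → ℂ) (K : Finset (Fin n))
    (l : Fin n → Fin 2) (hl : ∀ i, l i = if i ∈ K then 1 else 0) :
    (∏ i : Fin n, ∏ j : Fin n,
      if (i : ℕ) < (j : ℕ) then
        1 + (((l i : ℕ) : ℂ) - ((l j : ℕ) : ℂ)) * d / Complex.sinh (θ i - θ j)
      else 1) =
      subsetWeight (-(2 * d)) (fun i => Complex.exp (θ i)) univ K := by
  have hw : subsetWeight (-(2 * d)) (fun i => Complex.exp (θ i)) univ K =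
      ∏ i : Fin n, ∏ j : Fin n,
        if i ∉ K ∧ j ∈ K then 1 + d / Complex.sinh (θ j - θ i) else 1 := by
    rw [subsetWeight, ← prod_subset (subset_univ (univ \ K))]
    · refine prod_congr rfl fun i hi => ?_
      rw [← prod_subset (subset_univ K)]
      · refine prod_congr rfl fun k hk => ?_
        rw [if_pos ⟨(mem_sdiff.1 hi).2, hk⟩, pairFactor_neg, pairFactor_exp]
      · intro k _ hk
        rw [if_neg fun h => hk h.2]
    · intro i _ hi
      refine prod_eq_one fun k _ => if_neg fun h => hi ?_
      simp [h.1]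
  rw [hw, ← prod_prod_ite_lt_mul_swap
    (fun i j => if i ∉ K ∧ j ∈ K then 1 + d / Complex.sinh (θ j - θ i) else 1)
    fun i => if_neg fun h => h.1 h.2]
  refine prod_congr rfl fun i _ => prod_congr rfl fun j _ => ?_
  have hs : Complex.sinh (θ j - θ i) = -Complex.sinh (θ i - θ j) := by
    rw [← Complex.sinh_neg, neg_sub]
  by_cases hi : i ∈ K <;> by_cases hj : j ∈ K <;> simp [hl, hi, hj, hs, div_neg, neg_div]

lemma Kfun_pq_eq_subsetGenFun (ν : ℝ) {q : ℂ} (hq : q ≠ 0) {n : ℕ} (θ : Fin n → ℂ) :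
    Kfun ν (pq q) θ = q ^ n *
      subsetGenFun (-(2 * (Complex.I * (Real.sin (Real.pi * ν) : ℂ)))) (-(q ^ 2)⁻¹)
        (fun i => Complex.exp (θ i)) univ := by
  rw [Kfun, subsetGenFun, mul_sum]
  refine sum_bij' (fun l _ => univ.filter fun i => l i = 1)
    (fun K _ i => if i ∈ K then 1 else 0) (by simp) (by simp) ?_ ?_ ?_
  · intro l _
    funext i
    rcases Fin.exists_fin_two.1 ⟨l i, rfl⟩ with h | h <;> simp [h]
  · intro K _
    ext i
    simp
  · intro l _
    have hl : ∀ i, l i = if i ∈ univ.filter (fun i => l i = 1) then 1 else 0 := by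
      intro i
      rcases Fin.exists_fin_two.1 ⟨l i, rfl⟩ with h | h <;> simp [h]
    set K := univ.filter fun i => l i = 1
    simp only [mul_assoc _ Complex.I]
    rw [prod_prod_exchange_eq_subsetWeight _ θ K l hl]
    have hsum : ∑ i, (l i : ℕ) = #K := by
      rw [card_eq_sum_ones, ← univ_inter K, ← sum_ite_mem]
      exact sum_congr rfl fun i _ => by rw [hl i]; split_ifs <;> rfl
    have hp : pq q θ l = q ^ n * ((q ^ 2)⁻¹) ^ #K := by
      have hq' : ∀ i, q ^ ((-1 : ℤ) ^ (l i : ℕ)) = q * if i ∈ K then (q ^ 2)⁻¹ else 1 := by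
        intro i
        rw [hl i]
        split_ifs
        · simp
          field_simp
        · simp
      simp only [pq, hq', prod_mul_distrib, prod_const, card_univ, Fintype.card_fin,
        prod_ite_mem, univ_inter]
    rw [hsum, hp, neg_pow (q ^ 2)⁻¹]
    ring

/-- subset-sum representation of the exponential K-function, eq. (5.11):
`K̃_n^{(q)}(θ) = Σ_{m=0}^n (−1)^m q^{n−2m} Σ_{|K|=m} Π_{i∉K} Π_{k∈K} (1 + i sin(πν)/sinh(θ_i − θ_k))`. -/
theorem Ktilde_q_subset_sum (ν : ℝ) (q : ℂ) (hq : q ≠ 0) (n : ℕ) (hn : 1 ≤ n)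
    (θ : Fin n → ℂ) (hθ : Admissible θ) :
    Kfun ν (pq q) θ =
      ∑ m ∈ Finset.range (n + 1), (-1 : ℂ) ^ m * q ^ ((n : ℤ) - 2 * (m : ℤ)) *
        ∑ K ∈ Finset.powersetCard m (Finset.univ : Finset (Fin n)),
          ∏ i ∈ (Finset.univ : Finset (Fin n)) \ K, ∏ k ∈ K,
            (1 + Complex.I * (Real.sin (Real.pi * ν) : ℂ) / Complex.sinh (θ i - θ k)) := by
  rw [Kfun_pq_eq_subsetGenFun ν hq θ, subsetGenFun_neg, subsetGenFun, sum_powerset, mul_sum, card_univ,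
    Fintype.card_fin]
  · refine sum_congr rfl fun m _ => ?_
    rw [mul_sum, mul_sum]
    refine sum_congr rfl fun K hK => ?_
    rw [(mem_powersetCard.1 hK).2, subsetWeight]
    simp only [pairFactor_exp]
    rw [← mul_assoc, zpow_sub₀ hq, zpow_mul, zpow_natCast, zpow_natCast, neg_pow (q ^ 2)⁻¹,
      inv_pow, div_eq_mul_inv]
    norm_cast
    ring
  · exact fun i _ => Complex.exp_ne_zero _
  · intro i _ j _ hij
    rw [exp_sq_sub_exp_sq]
    refine mul_ne_zero (mul_ne_zero (mul_ne_zero two_ne_zero (Complex.exp_ne_zero _))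
      (Complex.exp_ne_zero _)) ?_
    rcases lt_or_gt_of_ne hij with h | h
    · exact hθ i j h
    · rw [← neg_sub, Complex.sinh_neg]
      exact neg_ne_zero.2 (hθ j i h)
end

section
/- (Explicit three-particle K-function for powers of the field.) Let ν ∈ ℝ, let N ≥ 1 be an odd integer, and let θ = (θ_1, θ_2, θ_3) ∈ ℂ³ with sinh(θ_i − θ_j) ≠ 0 for 1 ≤ i < j ≤ 3 (hence also cosh((θ_i − θ_j)/2) ≠ 0). Then K̃_3^{(N)}(θ) = 2·(3^N − 3) − sin²(πν)·Π_{1 ≤ i < j ≤ 3} 1/cosh((θ_i − θ_j)/2). -/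
open Finset

/-- Half-angle form of `1/(S₁S₂) − 1/(S₁S₃) + 1/(S₂S₃)` for `S₁ = sinh (2x)`,
`S₂ = sinh (2(x+y))`, `S₃ = sinh (2y)`. -/
theorem inv_sinh_cyclic_sum (x y : ℂ) (hx : Complex.sinh (2 * x) ≠ 0)
    (hxy : Complex.sinh (2 * (x + y)) ≠ 0) (hy : Complex.sinh (2 * y) ≠ 0) :
    2 * (1 / (Complex.sinh (2 * x) * Complex.sinh (2 * (x + y)))
        - 1 / (Complex.sinh (2 * x) * Complex.sinh (2 * y))
        + 1 / (Complex.sinh (2 * (x + y)) * Complex.sinh (2 * y)))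
      = -(1 / Complex.cosh x * (1 / Complex.cosh (x + y)) * (1 / Complex.cosh y)) := by
  rw [Complex.sinh_two_mul] at hx hxy hy
  have key : Complex.sinh (2 * y) - Complex.sinh (2 * (x + y)) + Complex.sinh (2 * x)
      = -4 * (Complex.sinh x * Complex.sinh (x + y) * Complex.sinh y) := by
    simp only [Complex.sinh_two_mul, Complex.sinh_add, Complex.cosh_add]
    linear_combination
      (-2 * Complex.sinh y * Complex.cosh y) * Complex.cosh_sq x
        + (-2 * Complex.sinh x * Complex.cosh x) * Complex.cosh_sq y
  simp only [Complex.sinh_two_mul] at key ⊢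
  simp only [ne_eq, mul_eq_zero, not_or] at hx hxy hy
  obtain ⟨⟨_, hsx⟩, hcx⟩ := hx
  obtain ⟨⟨_, hsxy⟩, hcxy⟩ := hxy
  obtain ⟨⟨_, hsy⟩, hcy⟩ := hy
  generalize Complex.sinh (x + y) = S at *
  generalize Complex.cosh (x + y) = C at *
  field_simp
  linear_combination key / 2

theorem sum_fin_three_arrow_fin_two {M : Type*} [AddCommMonoid M] (f : (Fin 3 → Fin 2) → M) :
    ∑ l, f l = f ![0, 0, 0] + f ![0, 0, 1] + f ![0, 1, 0] + f ![0, 1, 1]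
      + f ![1, 0, 0] + f ![1, 0, 1] + f ![1, 1, 0] + f ![1, 1, 1] := by
  have huniv : (univ : Finset (Fin 3 → Fin 2)) =
      {![0, 0, 0], ![0, 0, 1], ![0, 1, 0], ![0, 1, 1],
        ![1, 0, 0], ![1, 0, 1], ![1, 1, 0], ![1, 1, 1]} := by decide
  rw [huniv]
  repeat rw [sum_insert (by decide)]
  rw [sum_singleton]
  simp only [add_assoc]

/-- explicit three-particle K-function for powers of the field: for odd
`N`, `K̃_3^{(N)}(θ) = 2(3^N − 3) − sin²(πν)·Π_{i<j} 1/cosh((θ_i − θ_j)/2)`. -/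
theorem Ktilde_three_particle (ν : ℝ) (N : ℕ) (hN1 : 1 ≤ N) (hN : Odd N)
    (θ : Fin 3 → ℂ) (hθ : Admissible θ) :
    Kfun ν (pN N) θ
      = 2 * ((3 : ℂ) ^ N - 3) - ((Real.sin (Real.pi * ν) : ℂ)) ^ 2 *
          (1 / Complex.cosh ((θ 0 - θ 1) / 2) *
           (1 / Complex.cosh ((θ 0 - θ 2) / 2)) *
           (1 / Complex.cosh ((θ 1 - θ 2) / 2))) := by
  have h01 := hθ 0 1 (by decide)
  have h02 := hθ 0 2 (by decide)
  have h12 := hθ 1 2 (by decide)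
  have e02 : (θ 0 - θ 2) / 2 = (θ 0 - θ 1) / 2 + (θ 1 - θ 2) / 2 := by ring
  have d01 : θ 0 - θ 1 = 2 * ((θ 0 - θ 1) / 2) := by ring
  have d02 : θ 0 - θ 2 = 2 * ((θ 0 - θ 1) / 2 + (θ 1 - θ 2) / 2) := by ring
  have d12 : θ 1 - θ 2 = 2 * ((θ 1 - θ 2) / 2) := by ring
  have key := inv_sinh_cyclic_sum ((θ 0 - θ 1) / 2) ((θ 1 - θ 2) / 2)
    (d01 ▸ h01) (d02 ▸ h02) (d12 ▸ h12)
  rw [← d01, ← d02, ← d12, ← e02] at key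
  rw [Kfun, sum_fin_three_arrow_fin_two]
  generalize (Real.sin (Real.pi * ν) : ℂ) = s
  have hneg_three : (-1 + -1 + -1 : ℂ) ^ N = -3 ^ N := by
    rw [← hN.neg_pow 3]; norm_num
  have hthree : (1 + 1 + 1 : ℂ) ^ N = 3 ^ N := by norm_num
  simp [pN, Fin.sum_univ_three, Fin.prod_univ_three, hneg_three, hthree, hN.neg_one_pow]
  simp only [one_div, mul_inv] at key
  simp only [div_eq_mul_inv] at key ⊢
  generalize (Complex.sinh (θ 0 - θ 1))⁻¹ = a at *
  generalize (Complex.sinh (θ 0 - θ 2))⁻¹ = b at *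
  generalize (Complex.sinh (θ 1 - θ 2))⁻¹ = c at *
  linear_combination s ^ 2 * key - 2 * s ^ 2 * (a * b - a * c + b * c) * Complex.I_sq
end
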